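/- arXiv:math/9503230 — 2 statements merged into one kernel-verified Lean document; each statement's English description precedes it below -/
import Mathlib

section
/- Let p > 3 be a prime. Then for every integer i ≥ 1, H^{2i+1}(Γ₀(p), ℤ) ≅ (ℤ/2)^{N(p)}, where N(p) = (p-7)/6 if p ≡ 1 (mod 12), (p+1)/6 if p ≡ 5 (mod 12), (p-1)/6 if p ≡ 7 (mod 12), and (p+7)/6 if p ≡ 11 (mod 12). -/
section OddCohAux
open CategoryTheory CategoryTheory.Limits

namespace OddCoh

section Homological
variable {k : Type} [CommRing k] {Γ : Type} [Group Γ]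

lemma shortExact_mk {A B C : Rep.{0} k Γ} (f : A ⟶ B) (g : B ⟶ C)
    (hf : Function.Injective f.hom) (hg : Function.Surjective g.hom)
    (hex : ∀ b, g.hom b = 0 → ∃ a, f.hom a = b)
    (w : f ≫ g = 0) :
    (ShortComplex.mk f g w).ShortExact where
  exact := by
    rw [← ShortComplex.exact_map_iff_of_faithful _ (forget₂ (Rep.{0} k Γ) (ModuleCat.{0} k))]
    rw [ShortComplex.moduleCat_exact_iff]
    intro b hb
    exact hex b hb
  mono_f := (Rep.mono_iff_injective f).2 hf
  epi_g := (Rep.epi_iff_surjective g).2 hg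

lemma H1_of_ses {X : ShortComplex (Rep.{0} k Γ)} (hX : X.ShortExact)
    (h : IsZero (groupCohomology X.X₂ 1)) :
    ∃ φ : X.X₃.ρ.invariants →ₗ[k] groupCohomology X.X₁ 1, Function.Surjective φ ∧
      ∀ z, φ z = 0 ↔ ∃ y ∈ X.X₂.ρ.invariants, X.g.hom y = z := by
  refine ⟨((groupCohomology.H0Iso X.X₃).inv ≫ groupCohomology.δ hX 0 1 rfl).hom, ?_, ?_⟩
  · have := groupCohomology.epi_δ_of_isZero hX 0 h
    have : Epi ((groupCohomology.H0Iso X.X₃).inv ≫ groupCohomology.δ hX 0 1 rfl) :=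
      epi_comp _ _
    exact (ModuleCat.epi_iff_surjective _).1 this
  · intro z
    have hex := groupCohomology.mapShortComplex₃_exact hX (i := 0) (j := 1) rfl
    rw [ShortComplex.moduleCat_exact_iff] at hex
    have hnat : ∀ y : groupCohomology X.X₂ 0, ((groupCohomology.H0Iso X.X₃).hom.hom
        ((groupCohomology.map (MonoidHom.id Γ) X.g 0).hom y)).1 =
        X.g.hom ((groupCohomology.H0Iso X.X₂).hom.hom y).1 := fun y =>
      congrArg Subtype.val congr(($(groupCohomology.map_id_comp_H0Iso_hom X.g)).hom y)
    have hinv : ∀ z, (groupCohomology.H0Iso X.X₃).hom.hom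
        ((groupCohomology.H0Iso X.X₃).inv.hom z) = z := fun z =>
      congr(($((groupCohomology.H0Iso X.X₃).inv_hom_id)).hom z)
    have hinv2 : ∀ z, (groupCohomology.H0Iso X.X₂).hom.hom
        ((groupCohomology.H0Iso X.X₂).inv.hom z) = z := fun z =>
      congr(($((groupCohomology.H0Iso X.X₂).inv_hom_id)).hom z)
    constructor
    · intro hz
      obtain ⟨y, hy⟩ := hex ((groupCohomology.H0Iso X.X₃).inv z) hz
      refine ⟨((groupCohomology.H0Iso X.X₂).hom y).1, ((groupCohomology.H0Iso X.X₂).hom y).2, ?_⟩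
      have h2 : (groupCohomology.map (MonoidHom.id Γ) X.g 0).hom y =
        (groupCohomology.H0Iso X.X₃).inv.hom z := hy
      have h1 := hnat y
      rw [h2, hinv] at h1
      exact h1.symm
    · rintro ⟨y, hy, hyz⟩
      have h4 : (groupCohomology.map (MonoidHom.id Γ) X.g 0).hom
          ((groupCohomology.H0Iso X.X₂).inv.hom ⟨y, hy⟩) =
          (groupCohomology.H0Iso X.X₃).inv.hom z := by
        apply (groupCohomology.H0Iso X.X₃).toLinearEquiv.injective
        apply Subtype.ext
        refine (hnat _).trans ?_
        rw [hinv2]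
        refine hyz.trans ?_
        exact congrArg Subtype.val (hinv z).symm
      have h5 := (groupCohomology.mapShortComplex₃ hX (i := 0) (j := 1) rfl).zero
      have h6 := congr(($h5).hom ((groupCohomology.H0Iso X.X₂).inv ⟨y, hy⟩))
      change (groupCohomology.δ hX 0 1 rfl).hom ((groupCohomology.H0Iso X.X₃).inv.hom z) = 0
      rw [← h4]
      exact h6

lemma H1_zero_of_ses {X : ShortComplex (Rep.{0} k Γ)} (hX : X.ShortExact)
    (h : IsZero (groupCohomology X.X₂ 1))
    (hs : ∀ z ∈ X.X₃.ρ.invariants, ∃ y ∈ X.X₂.ρ.invariants, X.g.hom y = z) :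
    IsZero (groupCohomology X.X₁ 1) := by
  obtain ⟨φ, h1, h2⟩ := H1_of_ses hX h
  rw [ModuleCat.isZero_iff_subsingleton]
  refine subsingleton_of_forall_eq 0 fun a => ?_
  obtain ⟨z, rfl⟩ := h1 a
  exact (h2 z).2 (hs z.1 z.2)

/-- a middle term squeezed between zeros -/
lemma isZero_X1 {X : ShortComplex (Rep.{0} k Γ)} (hX : X.ShortExact) (n : ℕ)
    (h3 : IsZero (groupCohomology X.X₃ n)) (h2 : IsZero (groupCohomology X.X₂ (n+1))) :
    IsZero (groupCohomology X.X₁ (n+1)) :=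
  (groupCohomology.mapShortComplex₁_exact hX (i := n) (j := n+1) rfl).isZero_of_both_zeros
    (h3.eq_of_src _ _) (h2.eq_of_tgt _ _)

/-- dimension shift -/
lemma dimShift {X : ShortComplex (Rep.{0} k Γ)} (hX : X.ShortExact) (n : ℕ)
    (h : IsZero (groupCohomology X.X₂ n)) (h' : IsZero (groupCohomology X.X₂ (n+1))) :
    Nonempty (groupCohomology X.X₃ n ≃ₗ[k] groupCohomology X.X₁ (n+1)) := by
  have := groupCohomology.isIso_δ_of_isZero hX n h h'
  exact ⟨(asIso (groupCohomology.δ hX n (n+1) rfl)).toLinearEquiv⟩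

/-- integer valued functions on a `Γ`-set -/
noncomputable def funRho (Γ : Type) [Group Γ] (X : Type) [MulAction Γ X] :
    Representation ℤ Γ (X → ℤ) where
  toFun g := LinearMap.funLeft ℤ ℤ (fun x => g⁻¹ • x)
  map_one' := by ext; simp [LinearMap.funLeft]
  map_mul' g h := by
    apply LinearMap.ext; intro f; funext x
    simp [LinearMap.funLeft, mul_smul]

@[simp] lemma funRho_apply (X : Type) [MulAction Γ X] (g : Γ) (f : X → ℤ) (x : X) :
    funRho Γ X g f x = f (g⁻¹ • x) := rfl

lemma mem_inv_fun (X : Type) [MulAction Γ X] (f : X → ℤ) :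
    f ∈ (funRho Γ X).invariants ↔ ∀ (g : Γ) x, f (g • x) = f x := by
  rw [Representation.mem_invariants]
  constructor
  · intro h g x
    have := congrFun (h g⁻¹) x
    simpa using this
  · intro h g
    funext x
    exact h _ _

noncomputable abbrev P (Γ : Type) [Group Γ] (X : Type) [MulAction Γ X] : Rep.{0} ℤ Γ :=
  Rep.of (funRho Γ X)

lemma acyclic_coind (B : Rep.{0} ℤ Γ) (n : ℕ) :
    IsZero (groupCohomology (Rep.coind (⊥ : Subgroup Γ).subtype
      (Rep.res (⊥ : Subgroup Γ).subtype B)) (n+1)) :=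
  (isZero_groupCohomology_succ_of_subsingleton _ n).of_iso (groupCohomology.coindIso _ (n+1))

lemma exists_sigma (X : Type) [MulAction Γ X] (hfree : ∀ (g : Γ) (x : X), g • x = x → g = 1) :
    ∃ σ : X → Γ, ∀ (g : Γ) (x : X), σ (g • x) = g * σ x := by
  classical
  let q : X → X := fun x => (Quotient.mk (MulAction.orbitRel Γ X) x).out
  have hq : ∀ x, ∃ g : Γ, g • q x = x := by
    intro x
    have : (MulAction.orbitRel Γ X).r (q x) x := Quotient.mk_out (s := MulAction.orbitRel Γ X) x
    have h2 := (MulAction.orbitRel Γ X).symm this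
    exact h2
  have hqg : ∀ (g : Γ) x, q (g • x) = q x := by
    intro g x
    have : Quotient.mk (MulAction.orbitRel Γ X) (g • x) = Quotient.mk (MulAction.orbitRel Γ X) x :=
      Quotient.sound (s := MulAction.orbitRel Γ X) ⟨g, rfl⟩
    simp only [q, this]
  choose σ hσ using hq
  refine ⟨σ, fun g x => ?_⟩
  have h1 := hσ (g • x)
  rw [hqg] at h1
  have h2 := hσ x
  have h3 : (σ x)⁻¹ • x = q x := by rw [inv_smul_eq_iff, h2]
  have h4 : ((g * σ x)⁻¹ * σ (g • x)) • q x = q x := by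
    rw [mul_smul, h1, mul_inv_rev, mul_smul, inv_smul_smul, h3]
  have := hfree _ _ h4
  rw [inv_mul_eq_one] at this
  exact this.symm

lemma acyclic_free (X : Type) [MulAction Γ X] (hfree : ∀ (g : Γ) (x : X), g • x = x → g = 1)
    (n : ℕ) : IsZero (groupCohomology (P Γ X) (n+1)) := by
  obtain ⟨σ, hσ⟩ := exists_sigma X hfree
  let C := (Rep.coind (⊥ : Subgroup Γ).subtype (Rep.res (⊥ : Subgroup Γ).subtype (P Γ X)))
  let i : P Γ X ⟶ C := Rep.resCoindToHom _ _ _ (𝟙 _)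
  let r : C ⟶ P Γ X := Rep.ofHom
    { toFun := fun f x => (f.1 (σ x)⁻¹ : X → ℤ) ((σ x)⁻¹ • x)
      map_add' := fun a b => rfl
      map_smul' := fun a b => rfl
      isIntertwining' := by
        intro g
        apply LinearMap.ext
        intro f
        funext x
        change (f.1 ((σ x)⁻¹ * g) : X → ℤ) ((σ x)⁻¹ • x) =
          (f.1 (σ (g⁻¹ • x))⁻¹ : X → ℤ) ((σ (g⁻¹ • x))⁻¹ • g⁻¹ • x)
        rw [hσ, mul_inv_rev, inv_inv, mul_smul, smul_inv_smul] }
  have hir : i ≫ r = 𝟙 _ := by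
    apply Rep.hom_ext
    apply Representation.IntertwiningMap.ext
    apply LinearMap.ext
    intro f
    funext x
    change f (((σ x)⁻¹)⁻¹ • (σ x)⁻¹ • x) = f x
    rw [inv_smul_smul]
  have h1 : (groupCohomology.functor ℤ Γ (n+1)).map i ≫ (groupCohomology.functor ℤ Γ (n+1)).map r = 𝟙 _ := by
    rw [← Functor.map_comp, hir, CategoryTheory.Functor.map_id]
  have h2 : IsZero ((groupCohomology.functor ℤ Γ (n+1)).obj C) := acyclic_coind (P Γ X) n
  change IsZero ((groupCohomology.functor ℤ Γ (n+1)).obj (P Γ X))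
  rw [IsZero.iff_id_eq_zero, ← h1, h2.eq_of_tgt ((groupCohomology.functor ℤ Γ (n+1)).map i) 0, zero_comp]

end Homological

section Ker
variable {k : Type} [CommRing k] {Γ : Type} [Group Γ]

/-- kernel of a morphism of representations -/
noncomputable abbrev K {A B : Rep.{0} k Γ} (f : A ⟶ B) : Rep.{0} k Γ :=
  Rep.subrepresentation A (LinearMap.ker f.hom.toLinearMap) (by
    intro g x hx
    have h := Rep.hom_comm_apply f g x
    have hx' : f.hom x = 0 := hx
    change f.hom (A.ρ g x) = 0
    rw [h, hx', map_zero])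

noncomputable abbrev kι {A B : Rep.{0} k Γ} (f : A ⟶ B) : K f ⟶ A :=
  Rep.subtype A _ _

lemma kι_apply {A B : Rep.{0} k Γ} (f : A ⟶ B) (x : K f) : (kι f).hom x = x.1 := rfl

noncomputable def klift {A B C : Rep.{0} k Γ} (f : A ⟶ B) (h : C ⟶ A)
    (w : ∀ c, f.hom (h.hom c) = 0) : C ⟶ K f :=
  Rep.ofHom
    { toLinearMap := LinearMap.codRestrict _ h.hom.toLinearMap w
      isIntertwining' := by
        intro g
        apply LinearMap.ext
        intro c
        apply Subtype.ext
        exact Rep.hom_comm_apply h g c }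

lemma klift_apply {A B C : Rep.{0} k Γ} (f : A ⟶ B) (h : C ⟶ A)
    (w : ∀ c, f.hom (h.hom c) = 0) (c : C) : ((klift f h w).hom c).1 = h.hom c := rfl

lemma comp_zero_of {A B C : Rep.{0} k Γ} (f : A ⟶ B) (g : B ⟶ C)
    (h : ∀ a, g.hom (f.hom a) = 0) : f ≫ g = 0 := by
  apply Rep.hom_ext
  apply Representation.IntertwiningMap.ext
  apply LinearMap.ext
  exact h

lemma ses_ker {A B : Rep.{0} k Γ} (f : A ⟶ B) (hf : Function.Surjective f.hom) :
    (ShortComplex.mk (kι f) f (comp_zero_of _ _ fun a => a.2)).ShortExact :=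
  shortExact_mk _ _ (fun _ _ h => Subtype.ext h) hf (fun b hb => ⟨(⟨b, hb⟩ : LinearMap.ker f.hom.toLinearMap), rfl⟩) _

lemma ses_lift {A B C D : Rep.{0} k Γ} (f : A ⟶ B) (h : C ⟶ A) (u : D ⟶ C)
    (w : ∀ c, f.hom (h.hom c) = 0) (hu : Function.Injective u.hom)
    (wu : ∀ d, h.hom (u.hom d) = 0) (hex : ∀ c, h.hom c = 0 → ∃ d, u.hom d = c)
    (hex' : ∀ a, f.hom a = 0 → ∃ c, h.hom c = a) :
    (ShortComplex.mk u (klift f h w) (comp_zero_of _ _ fun a => Subtype.ext (wu a))).ShortExact := by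
  refine shortExact_mk _ _ hu ?_ ?_ _
  · rintro ⟨a, ha⟩
    obtain ⟨c, hc⟩ := hex' a ha
    exact ⟨c, Subtype.ext hc⟩
  · intro b hb
    exact hex b (congrArg Subtype.val hb)

end Ker

/-- a copy of `ZMod 12` -/
abbrev Z12 : Type := ZMod 12

class HasChi (Γ : Type) [Group Γ] where
  chi : Γ → Z12
  chi_mul : ∀ g h, chi (g * h) = chi g + chi h

lemma chi_one {Γ : Type} [Group Γ] [HasChi Γ] : HasChi.chi (1 : Γ) = 0 := by
  have := HasChi.chi_mul (1 : Γ) 1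
  rw [mul_one] at this
  exact left_eq_add.1 this

instance {Γ : Type} [Group Γ] [HasChi Γ] : MulAction Γ Z12 where
  smul g j := HasChi.chi g + j
  one_smul j := by change HasChi.chi (1 : Γ) + j = j; rw [chi_one, zero_add]
  mul_smul g h j := by
    change HasChi.chi (g * h) + j = HasChi.chi g + (HasChi.chi h + j)
    rw [HasChi.chi_mul, add_assoc]

section Main
variable {Γ : Type} [Group Γ] [HasChi Γ]

lemma z12_smul (g : Γ) (j : Z12) : g • j = HasChi.chi g + j := rfl

lemma sum_smul (g : Γ) (f : Z12 → ℤ) : ∑ j, f (g • j) = ∑ j, f j :=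
  Equiv.sum_comp (MulAction.toPerm g) f

/-- summation along the fibres -/
noncomputable def tr (X : Type) [MulAction Γ X] : P Γ (X × Z12) ⟶ P Γ X :=
  Rep.ofHom
    { toFun := fun f x => ∑ j, f (x, j)
      map_add' := fun a b => by funext x; exact Finset.sum_add_distrib
      map_smul' := fun a b => by funext x; exact (Finset.mul_sum _ _ _).symm
      isIntertwining' := by
        intro g
        apply LinearMap.ext
        intro f
        funext x
        exact sum_smul g⁻¹ (fun j => f (g⁻¹ • x, j)) }

lemma tr_apply (X : Type) [MulAction Γ X] (f : X × Z12 → ℤ) (x : X) :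
    (tr (Γ := Γ) X).hom f x = ∑ j, f (x, j) := rfl

/-- pullback along equivariant maps -/
noncomputable def pull {X Y : Type} [MulAction Γ X] [MulAction Γ Y] (u : X → Y)
    (hu : ∀ (g : Γ) x, u (g • x) = g • u x) : P Γ Y ⟶ P Γ X :=
  Rep.ofHom
    { toFun := fun f x => f (u x)
      map_add' := fun a b => rfl
      map_smul' := fun a b => rfl
      isIntertwining' := by
        intro g
        apply LinearMap.ext
        intro f
        funext x
        exact congrArg f (hu _ _).symm }

lemma pull_apply {X Y : Type} [MulAction Γ X] [MulAction Γ Y] (u : X → Y)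
    (hu : ∀ (g : Γ) x, u (g • x) = g • u x) (f : Y → ℤ) (x : X) :
    (pull (Γ := Γ) u hu).hom f x = f (u x) := rfl

noncomputable def omt (X : Type) [MulAction Γ X] : P Γ (X × Z12) ⟶ P Γ (X × Z12) :=
  Rep.ofHom
    { toFun := fun f x => f x - f (x.1, x.2 + (1 : ZMod 12))
      map_add' := fun a b => by funext x; simp only [Pi.add_apply]; ring
      map_smul' := fun a b => by
        funext x; simp only [Pi.smul_apply, smul_eq_mul, RingHom.id_apply]; ring
      isIntertwining' := by
        intro g
        apply LinearMap.ext
        intro f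
        funext x
        change f _ - f (_, HasChi.chi g⁻¹ + (x.2 + _)) = f _ - f (_, HasChi.chi g⁻¹ + x.2 + _)
        rw [add_assoc]; rfl }

lemma omt_apply (X : Type) [MulAction Γ X] (f : X × Z12 → ℤ) (x : X) (j : Z12) :
    (omt (Γ := Γ) X).hom f (x, j) = f (x, j) - f (x, j + (1 : ZMod 12)) := rfl

/-- solving `s j - s (j+1) = r j` in a translation invariant way -/
noncomputable def solve (r : ZMod 12 → ℤ) (j : ZMod 12) : ℤ :=
  (-(∑ k : Fin 12, (k.val : ℤ) * r (j + (k.val : ZMod 12)))) / 12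

lemma solve_spec (r : ZMod 12 → ℤ) (hr : ∑ j, r j = 0) (j : ZMod 12) :
    solve r j - solve r (j + 1) = r j := by
  have h1 : ∑ k : Fin 12, r (j + (k.val : ZMod 12)) = 0 := by
    rw [← hr, ← Equiv.sum_comp (Equiv.addLeft j) r]
    refine Finset.sum_congr rfl fun k _ => ?_
    congr 2
    exact ZMod.natCast_zmod_val (n := 12) k
  have h2 : (-(∑ k : Fin 12, (k.val : ℤ) * r (j + (k.val : ZMod 12)))) =
      (-(∑ k : Fin 12, (k.val : ℤ) * r (j + 1 + (k.val : ZMod 12)))) + r j * 12 := by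
    have e : j + (12 : ZMod 12) = j := by rw [show (12 : ZMod 12) = 0 from rfl, add_zero]
    simp only [Fin.sum_univ_succ, Fin.val_succ, Fin.val_zero, Fin.sum_univ_zero] at h1 ⊢
    push_cast at h1 ⊢
    norm_num [add_assoc] at h1 ⊢
    rw [e]
    linarith
  unfold solve
  rw [h2, Int.add_mul_ediv_right _ _ (by norm_num)]
  ring

lemma tr_surj (X : Type) [MulAction Γ X] : Function.Surjective (tr (Γ := Γ) X).hom := by
  intro f
  refine ⟨fun x => if x.2 = 0 then f x.1 else 0, ?_⟩
  funext x
  rw [tr_apply]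
  simp

lemma omt_solve (X : Type) [MulAction Γ X] (r : X × Z12 → ℤ)
    (hr : (tr (Γ := Γ) X).hom r = 0) :
    (omt (Γ := Γ) X).hom (fun x => solve (fun j => r (x.1, j)) x.2) = r := by
  funext ⟨x, j⟩
  rw [omt_apply]
  exact solve_spec (fun j => r (x, j)) (congrFun hr x) j

noncomputable def inc (X : Type) [MulAction Γ X] : P Γ X ⟶ P Γ (X × Z12) :=
  pull Prod.fst (fun _ _ => rfl)

lemma tr_omt (X : Type) [MulAction Γ X] (f : X × Z12 → ℤ) :
    (tr (Γ := Γ) X).hom ((omt (Γ := Γ) X).hom f) = 0 := by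
  funext x
  change ∑ j, (f (x, j) - f (x, j + (1 : ZMod 12))) = 0
  rw [Finset.sum_sub_distrib]
  rw [sub_eq_zero, eq_comm]
  exact Equiv.sum_comp (Equiv.addRight (1 : ZMod 12)) (fun j => f (x, j))

lemma omt_ker (X : Type) [MulAction Γ X] (f : X × Z12 → ℤ)
    (h : (omt (Γ := Γ) X).hom f = 0) (x : X) (j : Z12) : f (x, j) = f (x, 0) := by
  have h1 : ∀ j : ZMod 12, f (x, j + (1 : ZMod 12)) = f (x, j) := by
    intro j
    have := congrFun h (x, j)
    rw [omt_apply] at this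
    exact (sub_eq_zero.1 this).symm
  have h2 : ∀ n : ℕ, f (x, (n : ZMod 12)) = f (x, 0) := by
    intro n
    induction n with
    | zero => rw [Nat.cast_zero]
    | succ n ih => rw [Nat.cast_succ, ← ih]; exact h1 _
  rw [← h2 (ZMod.val (n := 12) j), ZMod.natCast_zmod_val (n := 12) j]

/-- first half of the periodicity -/
lemma ses_a (X : Type) [MulAction Γ X] :
    (ShortComplex.mk (inc (Γ := Γ) X) (klift (tr X) (omt X) (tr_omt X))
      (comp_zero_of _ _ fun a => Subtype.ext (by
        funext x; rw [klift_apply]; exact sub_self _))).ShortExact := by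
  refine ses_lift _ _ _ _ ?_ ?_ ?_ ?_
  · intro f g h
    funext x
    exact congrFun h (x, 0)
  · intro f; funext x; exact sub_self _
  · intro c hc
    refine ⟨fun x => c (x, 0), ?_⟩
    funext ⟨x, j⟩
    exact (omt_ker X c hc x j).symm
  · intro r hr
    exact ⟨_, omt_solve X r hr⟩

/-- second half of the periodicity -/
lemma ses_b (X : Type) [MulAction Γ X] :
    (ShortComplex.mk (kι (tr (Γ := Γ) X)) (tr X)
      (comp_zero_of _ _ fun a => a.2)).ShortExact := ses_ker _ (tr_surj X)

def Good (Γ : Type) [Group Γ] [HasChi Γ] (X : Type) [MulAction Γ X] : Prop :=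
  ∀ (g : Γ) (x : X), g • x = x → HasChi.chi g = 0 → g = 1

lemma good_acyclic {X : Type} [MulAction Γ X] (h : Good Γ X) (n : ℕ) :
    IsZero (groupCohomology (P Γ (X × Z12)) (n + 1)) := by
  apply acyclic_free
  rintro g ⟨x, j⟩ hg
  refine h g x (congrArg Prod.fst hg) ?_
  have : HasChi.chi g + j = j := congrArg Prod.snd hg
  simpa using this

lemma good_H1 {X : Type} [MulAction Γ X] (h : Good Γ X) :
    IsZero (groupCohomology (P Γ X) 1) := by
  apply H1_zero_of_ses (ses_a X) (good_acyclic h 0)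
  rintro ⟨r, hr⟩ hinv
  have hinv' : r ∈ (funRho Γ (X × Z12)).invariants := by
    intro g
    exact congrArg Subtype.val (hinv g)
  rw [mem_inv_fun] at hinv'
  refine ⟨fun x => solve (fun j => r (x.1, j)) x.2, ?_, Subtype.ext (omt_solve X r hr)⟩
  change _ ∈ (funRho Γ (X × Z12)).invariants
  rw [mem_inv_fun]
  rintro g ⟨x, j⟩
  change solve (fun i => r (g • x, i)) (HasChi.chi g + j) = solve (fun i => r (x, i)) j
  unfold solve
  congr 2
  refine Finset.sum_congr rfl fun k _ => ?_
  congr 1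
  refine Eq.trans ?_ (hinv' g (x, j + (k.val : ZMod 12)))
  exact congrArg (fun t => r (g • x, t)) (add_assoc _ _ _)

end Main

section Tree
variable {Γ : Type} [Group Γ] [HasChi Γ]
variable {E VA VB : Type} [MulAction Γ E] [MulAction Γ VA] [MulAction Γ VB]

/-- coboundary of a bipartite graph -/
noncomputable def dd (a : E → VA) (b : E → VB) (ha : ∀ (g : Γ) x, a (g • x) = g • a x)
    (hb : ∀ (g : Γ) x, b (g • x) = g • b x) : P Γ (VA ⊕ VB) ⟶ P Γ E :=
  pull (X := E) (fun e => Sum.inl (a e)) (fun g x => by rw [ha]; rfl) -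
    pull (X := E) (fun e => Sum.inr (b e)) (fun g x => by rw [hb]; rfl)

lemma dd_apply (a : E → VA) (b : E → VB) (ha : ∀ (g : Γ) x, a (g • x) = g • a x)
    (hb : ∀ (g : Γ) x, b (g • x) = g • b x) (f : VA ⊕ VB → ℤ) (e : E) :
    (dd a b ha hb).hom f e = f (Sum.inl (a e)) - f (Sum.inr (b e)) := rfl

/-- the same, times `Z12` -/
noncomputable def dd12 (a : E → VA) (b : E → VB) (ha : ∀ (g : Γ) x, a (g • x) = g • a x)
    (hb : ∀ (g : Γ) x, b (g • x) = g • b x) : P Γ ((VA ⊕ VB) × Z12) ⟶ P Γ (E × Z12) :=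
  pull (fun e => (Sum.inl (a e.1), e.2)) (fun g x => by change (Sum.inl (a (g • x.1)), _) = _; rw [ha]; rfl) -
    pull (fun e => (Sum.inr (b e.1), e.2)) (fun g x => by change (Sum.inr (b (g • x.1)), _) = _; rw [hb]; rfl)

lemma dd12_apply (a : E → VA) (b : E → VB) (ha : ∀ (g : Γ) x, a (g • x) = g • a x)
    (hb : ∀ (g : Γ) x, b (g • x) = g • b x) (f : (VA ⊕ VB) × Z12 → ℤ) (e : E) (j : Z12) :
    (dd12 a b ha hb).hom f (e, j) = f (Sum.inl (a e), j) - f (Sum.inr (b e), j) := rfl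

/-- the map `(tr, d)` -/
noncomputable def hh (a : E → VA) (b : E → VB) (ha : ∀ (g : Γ) x, a (g • x) = g • a x)
    (hb : ∀ (g : Γ) x, b (g • x) = g • b x) :
    P Γ ((VA ⊕ VB) × Z12) ⟶ P Γ ((VA ⊕ VB) ⊕ (E × Z12)) :=
  Rep.ofHom
    { toFun := fun f => Sum.elim ((tr (Γ := Γ) (VA ⊕ VB)).hom f) ((dd12 a b ha hb).hom f)
      map_add' := fun x y => by
        rw [map_add, map_add]; funext z; cases z <;> rfl
      map_smul' := fun x y => by
        rw [map_smul, map_smul]; funext z; cases z <;> rfl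
      isIntertwining' := by
        intro g
        apply LinearMap.ext
        intro f
        funext z
        rcases z with z | z
        · exact congrFun (Rep.hom_comm_apply (tr (Γ := Γ) (VA ⊕ VB)) g f) z
        · exact congrFun (Rep.hom_comm_apply (dd12 a b ha hb) g f) z }

/-- the map `d - tr` -/
noncomputable def mm (a : E → VA) (b : E → VB) (ha : ∀ (g : Γ) x, a (g • x) = g • a x)
    (hb : ∀ (g : Γ) x, b (g • x) = g • b x) :
    P Γ ((VA ⊕ VB) ⊕ (E × Z12)) ⟶ P Γ E :=
  pull (Γ := Γ) (X := VA ⊕ VB) Sum.inl (fun _ _ => rfl) ≫ dd a b ha hb -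
    pull (Γ := Γ) (X := E × Z12) Sum.inr (fun _ _ => rfl) ≫ tr E

lemma mm_apply (a : E → VA) (b : E → VB) (ha : ∀ (g : Γ) x, a (g • x) = g • a x)
    (hb : ∀ (g : Γ) x, b (g • x) = g • b x) (f : (VA ⊕ VB) ⊕ (E × Z12) → ℤ) (e : E) :
    (mm a b ha hb).hom f e = f (Sum.inl (Sum.inl (a e))) - f (Sum.inl (Sum.inr (b e))) -
      ∑ j, f (Sum.inr (e, j)) := rfl

theorem abstract_main (a : E → VA) (b : E → VB) (ha : ∀ (g : Γ) x, a (g • x) = g • a x)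
    (hb : ∀ (g : Γ) x, b (g • x) = g • b x)
    (hne : Nonempty VA)
    (hE : Good Γ E) (hA : Good Γ VA) (hB : Good Γ VB)
    (hconn : ∀ v : VA ⊕ VB → ℤ, (∀ e, v (Sum.inl (a e)) = v (Sum.inr (b e))) →
      ∃ c, ∀ x, v x = c)
    (hsurj : ∀ φ : E → ℤ, ∃ v : VA ⊕ VB → ℤ, ∀ e, v (Sum.inl (a e)) - v (Sum.inr (b e)) = φ e)
    (i : ℕ) :
    ∃ φ : (P Γ E).ρ.invariants →ₗ[ℤ] groupCohomology (P Γ PUnit.{1}) (2 * i + 3),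
      Function.Surjective φ ∧ ∀ z, φ z = 0 ↔
        ∃ y ∈ (funRho Γ ((VA ⊕ VB) ⊕ (E × Z12))).invariants, (mm a b ha hb).hom y = z := by
  have hV : Good Γ (VA ⊕ VB) := by
    rintro g (x | x) h
    · exact hA g x (Sum.inl_injective h)
    · exact hB g x (Sum.inr_injective h)
  have hVE : Good Γ ((VA ⊕ VB) ⊕ (E × Z12)) := by
    rintro g (x | x) h
    · exact hV g x (Sum.inl_injective h)
    · exact hE g x.1 (congrArg Prod.fst (Sum.inr_injective h))
  -- (c)
  let u : P Γ (PUnit.{1} × Z12) ⟶ P Γ ((VA ⊕ VB) × Z12) :=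
    pull (fun x => (PUnit.unit, x.2)) (fun _ _ => rfl)
  have hu : Function.Injective u.hom := by
    intro f g h
    obtain ⟨x⟩ := hne
    funext ⟨_, j⟩
    exact congrFun h (Sum.inl x, j)
  have hud : ∀ f, (dd12 a b ha hb).hom (u.hom f) = 0 := by
    intro f; funext x; exact sub_self _
  have huex : ∀ f, (dd12 a b ha hb).hom f = 0 → ∃ c, u.hom c = f := by
    intro f hf
    have := fun j => hconn (fun x => f (x, j)) (fun e => sub_eq_zero.1 (congrFun hf (e, j)))
    choose c hc using this
    exact ⟨fun x => c x.2, by funext ⟨x, j⟩; exact (hc j x).symm⟩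
  have hdsurj : ∀ φ : E × Z12 → ℤ, ∃ v, (dd12 a b ha hb).hom v = φ := by
    intro φ
    have := fun j => hsurj (fun e => φ (e, j))
    choose v hv using this
    exact ⟨fun x => v x.2 x.1, by funext ⟨x, j⟩; exact hv j x⟩
  have hc := shortExact_mk u (dd12 a b ha hb) hu hdsurj huex (comp_zero_of _ _ hud)
  have hpt : ∀ n, IsZero (groupCohomology (P Γ (PUnit.{1} × Z12)) (n + 2)) := fun n =>
    isZero_X1 hc (n + 1) (good_acyclic hE n) (good_acyclic hV (n + 1))
  -- periodicity
  have hper : ∀ n, Nonempty (groupCohomology (P Γ PUnit.{1}) (n + 2) ≃ₗ[ℤ]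
      groupCohomology (P Γ PUnit.{1}) (n + 4)) := by
    intro n
    obtain ⟨e1⟩ := dimShift (ses_b (Γ := Γ) PUnit.{1}) (n + 2) (hpt n) (hpt (n + 1))
    obtain ⟨e2⟩ := dimShift (ses_a (Γ := Γ) PUnit.{1}) (n + 3) (hpt (n + 1)) (hpt (n + 2))
    exact ⟨e1.trans e2⟩
  have hper' : ∀ i : ℕ, Nonempty (groupCohomology (P Γ PUnit.{1}) 3 ≃ₗ[ℤ]
      groupCohomology (P Γ PUnit.{1}) (2 * i + 3)) := by
    intro i
    induction i with
    | zero => exact ⟨LinearEquiv.refl _ _⟩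
    | succ i ih =>
      obtain ⟨e⟩ := ih
      obtain ⟨e'⟩ := hper (2 * i + 1)
      exact ⟨e.trans e'⟩
  obtain ⟨e1⟩ := hper' i
  obtain ⟨e2⟩ := dimShift (ses_a (Γ := Γ) PUnit.{1}) 2 (hpt 0) (hpt 1)
  -- (d)
  have hmh : ∀ c, (mm a b ha hb).hom ((hh a b ha hb).hom c) = 0 := by
    intro c
    funext e
    change (∑ j, c (Sum.inl (a e), j)) - (∑ j, c (Sum.inr (b e), j)) -
      ∑ j, (c (Sum.inl (a e), j) - c (Sum.inr (b e), j)) = 0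
    rw [Finset.sum_sub_distrib, sub_self]
  have hd := ses_lift (mm a b ha hb) (hh a b ha hb) (kι (tr (Γ := Γ) PUnit.{1}) ≫ u) hmh
    (by
      intro x y h
      exact Subtype.ext (hu h))
    (by
      intro d
      funext z
      rcases z with z | z
      · exact congrFun d.2 PUnit.unit
      · exact congrFun (hud d.1) z)
    (by
      intro c hcz
      have h1 : (tr (Γ := Γ) (VA ⊕ VB)).hom c = 0 := by
        funext x; exact congrFun hcz (Sum.inl x)
      have h2 : (dd12 a b ha hb).hom c = 0 := by
        funext x; exact congrFun hcz (Sum.inr x)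
      obtain ⟨f, rfl⟩ := huex c h2
      refine ⟨(⟨f, ?_⟩ : LinearMap.ker (tr (Γ := Γ) PUnit.{1}).hom.toLinearMap), rfl⟩
      obtain ⟨x⟩ := hne
      funext y
      exact congrFun h1 (Sum.inl x))
    (by
      intro f hf
      obtain ⟨v, hv⟩ := hdsurj (fun x => f (Sum.inr x))
      obtain ⟨c, hc⟩ := hconn (fun x => (∑ j, v (x, j)) - f (Sum.inl x)) (by
        intro e
        have h1 := congrFun hf e
        rw [mm_apply] at h1
        have h2 : ∀ j, f (Sum.inr (e, j)) = v (Sum.inl (a e), j) - v (Sum.inr (b e), j) :=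
          fun j => (congrFun hv (e, j)).symm
        simp only [h2, Finset.sum_sub_distrib] at h1
        change _ = (0 : ℤ) at h1
        linarith)
      refine ⟨fun x => v x - if x.2 = 0 then c else 0, ?_⟩
      funext z
      rcases z with z | z
      · change ∑ j, (v (z, j) - if j = 0 then c else 0) = f (Sum.inl z)
        rw [Finset.sum_sub_distrib, Finset.sum_ite_eq' Finset.univ (0 : Z12) (fun _ => c)]
        have := hc z
        simp only [Finset.mem_univ, if_true]
        linarith
      · obtain ⟨e, j⟩ := z
        refine Eq.trans ?_ (congrFun hv (e, j))
        change (v (Sum.inl (a e), j) - if j = 0 then c else 0) -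
          (v (Sum.inr (b e), j) - if j = 0 then c else 0) =
          v (Sum.inl (a e), j) - v (Sum.inr (b e), j)
        ring)
  obtain ⟨e3⟩ := dimShift hd 1 (good_acyclic hV 0) (good_acyclic hV 1)
  -- (e)
  have hmsurj : Function.Surjective (mm a b ha hb).hom := by
    intro φ
    obtain ⟨v, hv⟩ := hsurj φ
    refine ⟨Sum.elim v 0, ?_⟩
    funext e
    rw [mm_apply]
    simp [hv]
  obtain ⟨φ, h1, h2⟩ := H1_of_ses (ses_ker (mm a b ha hb) hmsurj) (good_H1 hVE)
  let ee := (e3.trans e2).trans e1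
  refine ⟨ee.toLinearMap ∘ₗ φ, ee.surjective.comp h1, fun z => ?_⟩
  rw [← h2 z]
  exact ee.map_eq_zero_iff

end Tree

section Chi
open ModularGroup MatrixGroups

/-- integral polynomial whose reduction mod 12 is the abelianization map -/
def chiPoly (a b c d : ℤ) : ℤ := (1 - c ^ 2) * (b * d + 3 * (c - 1) * d + c + 3) + c * (a + d - 3)

lemma zmod12_of (x : ℤ) (h3 : (x : ZMod 3) = 0) (h4 : (x : ZMod 4) = 0) : (x : ZMod 12) = 0 := by
  rw [ZMod.intCast_zmod_eq_zero_iff_dvd] at *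
  push_cast at *
  omega

lemma chiPoly_T (a b c d : ℤ) (hdet : a * d - b * c = 1) :
    ((chiPoly a (a + b) c (c + d) - chiPoly a b c d - 1 : ℤ) : ZMod 12) = 0 := by
  apply zmod12_of
  · have h : ((a * d - b * c : ℤ) : ZMod 3) = 1 := by rw [hdet]; simp
    unfold chiPoly
    push_cast at h ⊢
    generalize (a : ZMod 3) = a at *
    generalize (b : ZMod 3) = b at *
    generalize (c : ZMod 3) = c at *
    generalize (d : ZMod 3) = d at *
    revert a b c d
    decide
  · have h : ((a * d - b * c : ℤ) : ZMod 4) = 1 := by rw [hdet]; simp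
    unfold chiPoly
    push_cast at h ⊢
    generalize (a : ZMod 4) = a at *
    generalize (b : ZMod 4) = b at *
    generalize (c : ZMod 4) = c at *
    generalize (d : ZMod 4) = d at *
    clear hdet
    revert a b c d
    decide

lemma chiPoly_S (a b c d : ℤ) (hdet : a * d - b * c = 1) :
    ((chiPoly b (-a) d (-c) - chiPoly a b c d + 3 : ℤ) : ZMod 12) = 0 := by
  apply zmod12_of
  · have h : ((a * d - b * c : ℤ) : ZMod 3) = 1 := by rw [hdet]; simp
    unfold chiPoly
    push_cast at h ⊢
    generalize (a : ZMod 3) = a at *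
    generalize (b : ZMod 3) = b at *
    generalize (c : ZMod 3) = c at *
    generalize (d : ZMod 3) = d at *
    revert a b c d
    decide
  · have h : ((a * d - b * c : ℤ) : ZMod 4) = 1 := by rw [hdet]; simp
    unfold chiPoly
    push_cast at h ⊢
    generalize (a : ZMod 4) = a at *
    generalize (b : ZMod 4) = b at *
    generalize (c : ZMod 4) = c at *
    generalize (d : ZMod 4) = d at *
    clear hdet
    revert a b c d
    decide

/-- the abelianization map of `SL(2, ℤ)` -/
def chiG (g : SL(2, ℤ)) : ZMod 12 := (chiPoly (g 0 0) (g 0 1) (g 1 0) (g 1 1) : ℤ)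

lemma det_eq (g : SL(2, ℤ)) : g 0 0 * g 1 1 - g 0 1 * g 1 0 = 1 := by
  rw [← Matrix.det_fin_two]; exact g.2

lemma chiG_T : chiG T = 1 := by
  simp [chiG, chiPoly, T]

lemma chiG_S : chiG S = -3 := by
  simp [chiG, chiPoly, S]

lemma chiG_one : chiG 1 = 0 := by
  simp [chiG, chiPoly]

lemma mul_entry (g h : SL(2, ℤ)) (i j : Fin 2) :
    (g * h) i j = g i 0 * h 0 j + g i 1 * h 1 j := by
  change (g.1 * h.1) i j = _
  rw [Matrix.mul_apply, Fin.sum_univ_two]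

lemma mulT (g : SL(2, ℤ)) : (g * T) 0 0 = g 0 0 ∧ (g * T) 0 1 = g 0 0 + g 0 1 ∧
    (g * T) 1 0 = g 1 0 ∧ (g * T) 1 1 = g 1 0 + g 1 1 := by
  simp only [mul_entry]
  simp [T]

lemma mulS (g : SL(2, ℤ)) : (g * S) 0 0 = g 0 1 ∧ (g * S) 0 1 = -g 0 0 ∧
    (g * S) 1 0 = g 1 1 ∧ (g * S) 1 1 = -g 1 0 := by
  simp only [mul_entry]
  simp [S]

lemma chiG_mul_T (g : SL(2, ℤ)) : chiG (g * T) = chiG g + chiG T := by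
  obtain ⟨h1, h2, h3, h4⟩ := mulT g
  have := chiPoly_T _ _ _ _ (det_eq g)
  rw [chiG_T, chiG, h1, h2, h3, h4]
  push_cast at this
  rw [chiG]
  linear_combination this

lemma chiG_mul_S (g : SL(2, ℤ)) : chiG (g * S) = chiG g + chiG S := by
  obtain ⟨h1, h2, h3, h4⟩ := mulS g
  have := chiPoly_S _ _ _ _ (det_eq g)
  rw [chiG_S, chiG, h1, h2, h3, h4]
  push_cast at this
  rw [chiG]
  linear_combination this

lemma chiG_mul (g h : SL(2, ℤ)) : chiG (g * h) = chiG g + chiG h := by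
  have hh : h ∈ Subgroup.closure {S, T} := by
    rw [SpecialLinearGroup.SL2Z_generators]; trivial
  induction hh using Subgroup.closure_induction generalizing g with
  | mem x hx =>
    rcases hx with rfl | rfl
    · exact chiG_mul_S g
    · exact chiG_mul_T g
  | one => simp [chiG_one]
  | mul x y _ _ hx hy => rw [← mul_assoc, hy, hx, hy, add_assoc]
  | inv x _ hx =>
    have h1 := hx (g * x⁻¹)
    have h2 := hx (x⁻¹)
    rw [inv_mul_cancel_right] at h1
    rw [inv_mul_cancel, chiG_one] at h2
    rw [h1]
    linear_combination h2

/-- the element of order 6 -/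
def Wm : SL(2, ℤ) := ⟨!![0, 1; -1, 1], by simp [Matrix.det_fin_two]⟩

lemma chiG_W : chiG Wm = 2 := by
  simp [chiG, chiPoly, Wm]; try rfl

lemma chiG_neg_one : chiG (-1) = 6 := by
  simp [chiG, chiPoly]; try rfl

lemma S_sq : S ^ 2 = (-1 : SL(2, ℤ)) := by decide

lemma W_cube : Wm ^ 3 = (-1 : SL(2, ℤ)) := by decide

lemma SWT : S * Wm * T = 1 := by decide

lemma mulW (g : SL(2, ℤ)) : (g * Wm) 0 0 = -g 0 1 ∧ (g * Wm) 0 1 = g 0 0 + g 0 1 ∧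
    (g * Wm) 1 0 = -g 1 1 ∧ (g * Wm) 1 1 = g 1 0 + g 1 1 := by
  simp only [mul_entry]
  simp [Wm]

end Chi

section TreeSL
open ModularGroup MatrixGroups

/-- dot product of the columns -/
def ss (g : SL(2, ℤ)) : ℤ := g 0 0 * g 0 1 + g 1 0 * g 1 1
/-- squared length of the first column -/
def n1 (g : SL(2, ℤ)) : ℤ := g 0 0 ^ 2 + g 1 0 ^ 2
/-- squared length of the second column -/
def n2 (g : SL(2, ℤ)) : ℤ := g 0 1 ^ 2 + g 1 1 ^ 2

lemma lagr (g : SL(2, ℤ)) : n1 g * n2 g = ss g ^ 2 + 1 := by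
  have h := det_eq g
  simp only [n1, n2, ss]
  linear_combination (g 0 0 * g 1 1 - g 0 1 * g 1 0 + 1) * h

lemma n1_nonneg (g : SL(2, ℤ)) : 0 ≤ n1 g := by unfold n1; positivity
lemma n2_nonneg (g : SL(2, ℤ)) : 0 ≤ n2 g := by unfold n2; positivity
lemma n1_pos (g : SL(2, ℤ)) : 0 < n1 g := by
  rcases (n1_nonneg g).lt_or_eq with h | h
  · exact h
  · have := lagr g; rw [← h] at this; nlinarith
lemma n2_pos (g : SL(2, ℤ)) : 0 < n2 g := by
  rcases (n2_nonneg g).lt_or_eq with h | h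
  · exact h
  · have := lagr g; rw [← h] at this; nlinarith

set_option linter.unusedSimpArgs false

lemma ss_S (g : SL(2, ℤ)) : ss (g * S) = -ss g := by
  obtain ⟨h1, h2, h3, h4⟩ := mulS g
  simp only [ss, h1, h2, h3, h4]; ring
lemma n1_S (g : SL(2, ℤ)) : n1 (g * S) = n2 g := by
  obtain ⟨h1, h2, h3, h4⟩ := mulS g
  simp only [n1, n2, h1, h2, h3, h4]
lemma n2_S (g : SL(2, ℤ)) : n2 (g * S) = n1 g := by
  obtain ⟨h1, h2, h3, h4⟩ := mulS g
  simp only [n1, n2, h1, h2, h3, h4]; ring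
lemma ss_W (g : SL(2, ℤ)) : ss (g * Wm) = -ss g - n2 g := by
  obtain ⟨h1, h2, h3, h4⟩ := mulW g
  simp only [ss, n2, h1, h2, h3, h4]; ring
lemma n1_W (g : SL(2, ℤ)) : n1 (g * Wm) = n2 g := by
  obtain ⟨h1, h2, h3, h4⟩ := mulW g
  simp only [n1, n2, h1, h2, h3, h4]; ring
lemma n2_W (g : SL(2, ℤ)) : n2 (g * Wm) = n1 g + n2 g + 2 * ss g := by
  obtain ⟨h1, h2, h3, h4⟩ := mulW g
  simp only [ss, n1, n2, h1, h2, h3, h4]; ring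

lemma not_all_neg (g : SL(2, ℤ)) (h1 : ss g < 0) (h2 : ss (g * Wm) < 0) :
    0 ≤ ss (g * Wm * Wm) := by
  by_contra h3
  rw [ss_W, ss_W, n2_W] at h3
  rw [ss_W] at h2
  have := lagr g
  have e1 : -ss g + 1 ≤ n2 g := by linarith
  have e2 : -ss g + 1 ≤ n1 g := by linarith
  nlinarith [mul_le_mul e2 e1 (by linarith) (n1_nonneg g)]

/-- measure for the recursion -/
def mu (g : SL(2, ℤ)) : ℕ := 2 * (n1 g + n2 g).toNat + if 0 < ss g then 1 else 0

lemma mu_S (g : SL(2, ℤ)) (h : 0 < ss g) : mu (g * S) < mu g := by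
  unfold mu
  rw [n1_S, n2_S, ss_S, if_pos h, if_neg (by linarith), add_comm (n1 g)]
  omega

lemma mu_lt (g h : SL(2, ℤ)) (hh : n1 g + n2 g < n1 h + n2 h) : mu g < mu h := by
  unfold mu
  have := n1_pos g
  have := n2_pos g
  split_ifs <;> omega

lemma mu_W (g : SL(2, ℤ)) (h : ss g < 0) (h2 : 0 ≤ ss (g * Wm)) : mu (g * Wm) < mu g := by
  apply mu_lt
  rw [n1_W, n2_W]
  rw [ss_W] at h2
  linarith

lemma mu_WW (g : SL(2, ℤ)) (h : ss g < 0) (h2 : 0 ≤ ss (g * Wm * Wm)) :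
    mu (g * Wm * Wm) < mu g := by
  apply mu_lt
  simp only [n1_W, n2_W, ss_W] at h2 ⊢
  linarith

/-- the recursive solution of the tree equation -/
def uu (φ : SL(2, ℤ) → ℤ) (g : SL(2, ℤ)) : ℤ :=
  if ss g = 0 then 0
  else if _h1 : 0 < ss g then uu φ (g * S)
  else if _h2 : 0 ≤ ss (g * Wm) then uu φ (g * Wm) + φ g - φ (g * Wm)
  else uu φ (g * Wm * Wm) + φ g - φ (g * Wm * Wm)
termination_by mu g
decreasing_by
  · exact mu_S g _h1
  · exact mu_W g (by omega) _h2
  · exact mu_WW g (by omega) (not_all_neg g (by omega) (by omega))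

lemma uu_zero (φ : SL(2, ℤ) → ℤ) (g : SL(2, ℤ)) (h : ss g = 0) : uu φ g = 0 := by
  rw [uu, if_pos h]

lemma uu_pos (φ : SL(2, ℤ) → ℤ) (g : SL(2, ℤ)) (h : 0 < ss g) : uu φ g = uu φ (g * S) := by
  rw [uu, if_neg h.ne', dif_pos h]

lemma uu_W (φ : SL(2, ℤ) → ℤ) (g : SL(2, ℤ)) (h : ss g < 0) (h2 : 0 ≤ ss (g * Wm)) :
    uu φ g = uu φ (g * Wm) + φ g - φ (g * Wm) := by
  rw [uu, if_neg h.ne, dif_neg (by omega), dif_pos h2]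

lemma uu_WW (φ : SL(2, ℤ) → ℤ) (g : SL(2, ℤ)) (h : ss g < 0) (h2 : ss (g * Wm) < 0) :
    uu φ g = uu φ (g * Wm * Wm) + φ g - φ (g * Wm * Wm) := by
  rw [uu, if_neg h.ne, dif_neg (by omega), dif_neg (by omega)]

lemma ss_neg (g : SL(2, ℤ)) : ss (-g) = ss g := by simp [ss]

lemma uu_neg (φ : SL(2, ℤ) → ℤ) (hφ : ∀ g, φ (-g) = φ g) (g : SL(2, ℤ)) : uu φ (-g) = uu φ g := by
  induction hn : mu g using Nat.strong_induction_on generalizing g with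
  | _ n ih =>
    subst hn
    rcases lt_trichotomy (ss g) 0 with h | h | h
    · by_cases h2 : 0 ≤ ss (g * Wm)
      · rw [uu_W φ g h h2, uu_W φ (-g) (by rwa [ss_neg]) (by rwa [neg_mul, ss_neg]), neg_mul,
          ih _ (mu_W g h h2) _ rfl, hφ, hφ]
      · rw [uu_WW φ g h (by omega), uu_WW φ (-g) (by rwa [ss_neg]) (by rw [neg_mul, ss_neg]; omega),
          neg_mul, neg_mul, ih _ (mu_WW g h (not_all_neg g h (by omega))) _ rfl, hφ, hφ]
    · rw [uu_zero φ g h, uu_zero φ (-g) (by rwa [ss_neg])]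
    · rw [uu_pos φ g h, uu_pos φ (-g) (by rwa [ss_neg]), neg_mul, ih _ (mu_S g h) _ rfl]

lemma uu_S (φ : SL(2, ℤ) → ℤ) (hφ : ∀ g, φ (-g) = φ g) (g : SL(2, ℤ)) :
    uu φ (g * S) = uu φ g := by
  rcases lt_trichotomy (ss g) 0 with h | h | h
  · rw [uu_pos φ (g * S) (by rw [ss_S]; omega), mul_assoc, ← pow_two, S_sq, mul_neg, mul_one,
      uu_neg φ hφ]
  · rw [uu_zero φ g h, uu_zero φ _ (by rw [ss_S]; omega)]
  · rw [uu_pos φ g h]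

lemma uu_sub_W (φ : SL(2, ℤ) → ℤ) (hφ : ∀ g, φ (-g) = φ g) (g : SL(2, ℤ)) :
    uu φ (g * Wm) - φ (g * Wm) = uu φ g - φ g := by
  have hW3 : g * Wm * Wm * Wm = -g := by
    rw [mul_assoc, mul_assoc, ← pow_two, ← pow_succ', W_cube, mul_neg, mul_one]
  by_cases h : ss g < 0
  · by_cases h2 : 0 ≤ ss (g * Wm)
    · rw [uu_W φ g h h2]; ring
    · rw [uu_WW φ g h (by omega), uu_W φ (g * Wm) (by omega) (not_all_neg g h (by omega))]; ring
  · have e1 : ss (g * Wm) < 0 := by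
      rw [ss_W]; have := n2_pos g; omega
    have e2 : ss (g * Wm * Wm) < 0 := by
      rw [ss_W, ss_W, n2_W]; have := n1_pos g; omega
    rw [uu_WW φ (g * Wm) e1 e2, hW3, uu_neg φ hφ, hφ]; ring

end TreeSL

section Cosets
open ModularGroup MatrixGroups

lemma chiG_inv (g : SL(2, ℤ)) : chiG g⁻¹ = -chiG g := by
  have h := chiG_mul g⁻¹ g
  rw [inv_mul_cancel, chiG_one] at h
  linear_combination -h

lemma chiG_pow (g : SL(2, ℤ)) (k : ℕ) : chiG (g ^ k) = k * chiG g := by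
  induction k with
  | zero => simp [chiG_one]
  | succ k ih => rw [pow_succ, chiG_mul, ih]; push_cast; ring

lemma chiG_zpow (g : SL(2, ℤ)) (k : ℤ) : chiG (g ^ k) = k * chiG g := by
  obtain ⟨n, rfl | rfl⟩ := k.eq_nat_or_neg
  · rw [zpow_natCast, chiG_pow]; simp
  · rw [zpow_neg, chiG_inv, zpow_natCast, chiG_pow]; push_cast; ring

instance (Γ : Subgroup SL(2, ℤ)) : HasChi Γ where
  chi g := chiG g.1
  chi_mul g h := chiG_mul g.1 h.1

/-- left cosets of a cyclic subgroup -/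
abbrev Q (s : SL(2, ℤ)) : Type := SL(2, ℤ) ⧸ Subgroup.zpowers s

/-- the coset map -/
abbrev mkQ (s g : SL(2, ℤ)) : Q s := QuotientGroup.mk g

lemma mkQ_eq (s g h : SL(2, ℤ)) : mkQ s g = mkQ s h ↔ ∃ k : ℤ, h = g * s ^ k := by
  rw [QuotientGroup.eq, Subgroup.mem_zpowers_iff]
  constructor
  · rintro ⟨k, hk⟩; exact ⟨k, by rw [hk]; group⟩
  · rintro ⟨k, rfl⟩; exact ⟨k, by group⟩

lemma smul_mkQ (Γ : Subgroup SL(2, ℤ)) (γ : Γ) (s g : SL(2, ℤ)) :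
    γ • mkQ s g = mkQ s (γ.1 * g) := rfl

lemma good_Q (Γ : Subgroup SL(2, ℤ)) (s : SL(2, ℤ))
    (hs : ∀ k : ℤ, (k : ZMod 12) * chiG s = 0 → s ^ k = 1) : Good Γ (Q s) := by
  intro γ x
  induction x using QuotientGroup.induction_on with
  | _ g =>
    intro h1 h2
    change mkQ s (γ.1 * g) = mkQ s g at h1
    obtain ⟨k, hk⟩ := (mkQ_eq _ _ _).1 h1.symm
    have h3 : chiG (γ.1 * g) = chiG g + k * chiG s := by rw [hk, chiG_mul, chiG_zpow]
    rw [chiG_mul, show chiG γ.1 = 0 from h2] at h3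
    have h4 := hs k (by linear_combination -h3)
    rw [h4, mul_one] at hk
    exact Subtype.ext (mul_eq_right.1 hk)

/-- functions on cosets from invariant functions -/
def liftQ {A : Type} (s : SL(2, ℤ)) (f : SL(2, ℤ) → A) (hf : ∀ g, f (g * s) = f g) : Q s → A :=
  fun x => Quotient.liftOn' x f (by
    intro g h hgh
    have h1 : mkQ s g = mkQ s h := Quotient.sound' hgh
    obtain ⟨k, rfl⟩ := (mkQ_eq _ _ _).1 h1
    clear h1 hgh
    induction k with
    | zero => simp
    | succ n ih => rw [zpow_add_one, ← mul_assoc, hf, ih]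
    | pred n ih => rw [ih, ← hf (g * s ^ (-(n : ℤ) - 1)), mul_assoc, ← zpow_add_one, sub_add_cancel])

lemma liftQ_mk {A : Type} (s : SL(2, ℤ)) (f : SL(2, ℤ) → A) (hf : ∀ g, f (g * s) = f g) (g) :
    liftQ s f hf (mkQ s g) = f g := rfl

lemma mkQ_mul (s g : SL(2, ℤ)) : mkQ s (g * s) = mkQ s g :=
  ((mkQ_eq _ _ _).2 ⟨1, by rw [zpow_one]⟩).symm

lemma mkQ_S_neg (g : SL(2, ℤ)) : mkQ S (g * -1) = mkQ S g :=
  ((mkQ_eq _ _ _).2 ⟨2, by rw [← S_sq]; rfl⟩).symm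

lemma mkQ_W_neg (g : SL(2, ℤ)) : mkQ Wm (g * -1) = mkQ Wm g :=
  ((mkQ_eq _ _ _).2 ⟨3, by rw [← W_cube]; rfl⟩).symm

/-- edges to vertices of the first kind -/
def qa : Q (-1) → Q S := liftQ _ (mkQ S) mkQ_S_neg
/-- edges to vertices of the second kind -/
def qb : Q (-1) → Q Wm := liftQ _ (mkQ Wm) mkQ_W_neg

lemma qa_mk (g) : qa (mkQ _ g) = mkQ S g := rfl
lemma qb_mk (g) : qb (mkQ _ g) = mkQ Wm g := rfl

lemma mk_ind {s : SL(2, ℤ)} {p : Q s → Prop} (h : ∀ g, p (mkQ s g)) (x) : p x :=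
  QuotientGroup.induction_on x h

lemma qa_equiv (Γ : Subgroup SL(2, ℤ)) (γ : Γ) (x : Q (-1)) : qa (γ • x) = γ • qa x := by
  revert x; exact mk_ind fun g => rfl
lemma qb_equiv (Γ : Subgroup SL(2, ℤ)) (γ : Γ) (x : Q (-1)) : qb (γ • x) = γ • qb x := by
  revert x; exact mk_ind fun g => rfl

lemma zpow_eq_one_of {g : SL(2, ℤ)} {n : ℕ} (h : g ^ n = 1) {k : ℤ} (hk : (n : ℤ) ∣ k) :
    g ^ k = 1 := by
  obtain ⟨m, rfl⟩ := hk
  rw [zpow_mul, zpow_natCast, h, one_zpow]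

lemma S_good (k : ℤ) (h : (k : ZMod 12) * chiG S = 0) : S ^ k = 1 := by
  apply zpow_eq_one_of (n := 4)
  · decide
  · rw [chiG_S] at h
    have : ((k * (-3) : ℤ) : ZMod 12) = 0 := by push_cast; exact h
    rw [ZMod.intCast_zmod_eq_zero_iff_dvd] at this
    push_cast at *; omega

lemma W_good (k : ℤ) (h : (k : ZMod 12) * chiG Wm = 0) : Wm ^ k = 1 := by
  apply zpow_eq_one_of (n := 6)
  · decide
  · rw [chiG_W] at h
    have : ((k * 2 : ℤ) : ZMod 12) = 0 := by push_cast; exact h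
    rw [ZMod.intCast_zmod_eq_zero_iff_dvd] at this
    push_cast at *; omega

lemma neg_good (k : ℤ) (h : (k : ZMod 12) * chiG (-1) = 0) : (-1 : SL(2, ℤ)) ^ k = 1 := by
  apply zpow_eq_one_of (n := 2)
  · decide
  · rw [chiG_neg_one] at h
    have : ((k * 6 : ℤ) : ZMod 12) = 0 := by push_cast; exact h
    rw [ZMod.intCast_zmod_eq_zero_iff_dvd] at this
    push_cast at *; omega

/-- a function right-invariant under `S` and `W` is constant -/
lemma const_of {A : Type} (f : SL(2, ℤ) → A) (hS : ∀ g, f (g * S) = f g)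
    (hW : ∀ g, f (g * Wm) = f g) (g : SL(2, ℤ)) : f g = f 1 := by
  have hT : ∀ g, f (g * T) = f g := by
    intro g
    have h : T = Wm⁻¹ * S⁻¹ := by
      have := SWT
      rw [← mul_inv_rev]; exact eq_inv_of_mul_eq_one_right this
    rw [h, ← mul_assoc, ← hS, inv_mul_cancel_right, ← hW, inv_mul_cancel_right]
  have key : ∀ h g : SL(2, ℤ), f (g * h) = f g := by
    intro h
    have hh : h ∈ Subgroup.closure {S, T} := by
      rw [SpecialLinearGroup.SL2Z_generators]; trivial
    induction hh using Subgroup.closure_induction with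
    | mem x hx =>
      rcases hx with rfl | rfl
      · exact hS
      · exact hT
    | one => simp
    | mul x y _ _ hx hy => intro g; rw [← mul_assoc, hy, hx]
    | inv x _ hx => intro g; rw [← hx, inv_mul_cancel_right]
  have := key g 1
  rwa [one_mul] at this

theorem main2 (Γ : Subgroup SL(2, ℤ)) (i : ℕ) :
    ∃ φ : (P Γ (Q (-1))).ρ.invariants →ₗ[ℤ] groupCohomology (P Γ PUnit.{1}) (2 * i + 3),
      Function.Surjective φ ∧ ∀ z, φ z = 0 ↔
        ∃ y ∈ (funRho Γ ((Q S ⊕ Q Wm) ⊕ (Q (-1) × Z12))).invariants,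
          (mm qa qb (qa_equiv Γ) (qb_equiv Γ)).hom y = z := by
  refine abstract_main qa qb (qa_equiv Γ) (qb_equiv Γ) ⟨mkQ _ 1⟩ (good_Q _ _ neg_good)
    (good_Q _ _ S_good) (good_Q _ _ W_good) ?_ ?_ i
  · intro v hv
    have hv' : ∀ g, v (Sum.inl (mkQ S g)) = v (Sum.inr (mkQ Wm g)) := fun g => hv (mkQ _ g)
    have hc := const_of (fun g => v (Sum.inl (mkQ S g))) (fun g => by simp only [mkQ_mul])
      (fun g => by simp only [hv', mkQ_mul])
    refine ⟨v (Sum.inl (mkQ S 1)), ?_⟩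
    rintro (x | x)
    · revert x; exact mk_ind hc
    · revert x; exact mk_ind fun g => (hv' g).symm.trans (hc g)
  · intro φ
    let ψ : SL(2, ℤ) → ℤ := fun g => φ (mkQ _ g)
    have hψ : ∀ g, ψ (-g) = ψ g := by
      intro g
      change φ (mkQ _ (-g)) = φ (mkQ _ g)
      rw [← mkQ_mul (-1) g, mul_neg, mul_one]
    refine ⟨Sum.elim (liftQ S (uu ψ) (uu_S ψ hψ))
      (liftQ Wm (fun g => uu ψ g - ψ g) (uu_sub_W ψ hψ)), ?_⟩
    apply mk_ind
    intro g
    rw [qa_mk, qb_mk, Sum.elim_inl, Sum.elim_inr, liftQ_mk, liftQ_mk, sub_sub_cancel]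

end Cosets

section Coker
open ModularGroup MatrixGroups

/-- invariant functions -/
def WI (Y : Type) [MulAction SL(2, ℤ) Y] (s : SL(2, ℤ)) : Submodule (ZMod 2) (Y → ZMod 2) where
  carrier := {F | ∀ y, F (s • y) = F y}
  add_mem' := by intro a b ha hb y; simp only [Pi.add_apply, ha y, hb y]
  zero_mem' := by intro y; rfl
  smul_mem' := by intro c a ha y; simp only [Pi.smul_apply, ha y]

lemma mem_WI (Y : Type) [MulAction SL(2, ℤ) Y] (s : SL(2, ℤ)) (F : Y → ZMod 2) :
    F ∈ WI Y s ↔ ∀ y, F (s • y) = F y := Iff.rfl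

lemma sum_even (f : ZMod 12 → ℤ) (hf : ∀ j, f (6 + j) = f j) :
    ((∑ j, f j : ℤ) : ZMod 2) = 0 := by
  have h : (∑ j, f j) = ∑ j : Fin 6, (f ((j : ℕ) : ZMod 12) + f (6 + ((j : ℕ) : ZMod 12))) := by
    have e : (Finset.univ : Finset (ZMod 12)) =
        (Finset.univ.image fun j : Fin 6 => ((j : ℕ) : ZMod 12)) ∪
        (Finset.univ.image fun j : Fin 6 => 6 + ((j : ℕ) : ZMod 12)) := by decide
    rw [e, Finset.sum_union (by decide), Finset.sum_image (by decide), Finset.sum_image (by decide),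
      Finset.sum_add_distrib]
  rw [h, ZMod.intCast_zmod_eq_zero_iff_dvd]
  apply Finset.dvd_sum
  intro j _
  rw [hf]
  exact ⟨f ((j : ℕ) : ZMod 12), by push_cast; ring⟩

lemma ind_sum (g : SL(2, ℤ)) :
    (∑ j : ZMod 12, (open Classical in if ∃ h, mkQ (-1) h = mkQ (-1) g ∧ chiG h = j then (1 : ℤ) else 0))
      = 2 := by
  classical
  have h0 : ∀ j, (∃ h, mkQ (-1) h = mkQ (-1) g ∧ chiG h = j) ↔
      j ∈ ({chiG g, chiG g + 6} : Finset (ZMod 12)) := by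
    intro j
    rw [Finset.mem_insert, Finset.mem_singleton]
    constructor
    · rintro ⟨h, h1, rfl⟩
      obtain ⟨k, rfl⟩ := (mkQ_eq _ _ _).1 h1.symm
      rw [chiG_mul, chiG_zpow, chiG_neg_one]
      rcases Int.even_or_odd k with hk | hk
      · left
        have h2 : ((k * 6 : ℤ) : ZMod 12) = 0 := by
          rw [ZMod.intCast_zmod_eq_zero_iff_dvd]; push_cast; obtain ⟨m, rfl⟩ := hk; omega
        push_cast at h2
        rw [h2, add_zero]
      · right
        have h2 : ((k * 6 - 6 : ℤ) : ZMod 12) = 0 := by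
          rw [ZMod.intCast_zmod_eq_zero_iff_dvd]; push_cast; obtain ⟨m, rfl⟩ := hk; omega
        push_cast at h2
        linear_combination h2
    · rintro (rfl | rfl)
      · exact ⟨g, rfl, rfl⟩
      · exact ⟨g * -1, mkQ_mul _ _, by rw [chiG_mul, chiG_neg_one]⟩
  simp only [h0]
  rw [Finset.sum_ite_mem, Finset.univ_inter, Finset.sum_const, Finset.card_pair]
  · rfl
  · intro h
    have h6 : (6 : ZMod 12) = 0 := left_eq_add.1 h
    revert h6; decide

variable {Y : Type} [MulAction SL(2, ℤ) Y] (Γ : Subgroup SL(2, ℤ)) (y0 : Y)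

theorem coker_iso (hstab : ∀ g : SL(2, ℤ), g • y0 = y0 ↔ g ∈ Γ)
    (htrans : ∀ y : Y, ∃ g : SL(2, ℤ), g • y0 = y)
    (hneg : ∀ y : Y, (-1 : SL(2, ℤ)) • y = y) :
    ∃ ψ : (P Γ (Q (-1))).ρ.invariants →+ ((Y → ZMod 2) ⧸ (WI Y S ⊔ WI Y Wm)),
      Function.Surjective ψ ∧ ∀ z, ψ z = 0 ↔
        ∃ y ∈ (funRho Γ ((Q S ⊕ Q Wm) ⊕ (Q (-1) × Z12))).invariants,
          (mm qa qb (qa_equiv Γ) (qb_equiv Γ)).hom y = z := by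
  classical
  choose sec hsec using htrans
  have hsec' : ∀ f : SL(2, ℤ) → ℤ, (∀ γ ∈ Γ, ∀ g, f (γ * g) = f g) → ∀ g,
      f (sec (g⁻¹ • y0))⁻¹ = f g := by
    intro f hf g
    have h1 : g * sec (g⁻¹ • y0) ∈ Γ := by
      rw [← hstab, mul_smul, hsec, smul_inv_smul]
    rw [← hf _ h1 (sec (g⁻¹ • y0))⁻¹, mul_inv_cancel_right]
  have hY : ∀ p : Y → Prop, (∀ g : SL(2, ℤ), p (g⁻¹ • y0)) → ∀ y, p y := by
    intro p hp y
    have := hp (sec y)⁻¹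
    rwa [inv_inv, hsec] at this
  have hnegΓ : (-1 : SL(2, ℤ)) ∈ Γ := (hstab _).1 (hneg _)
  -- invariance criterion
  have hWI : ∀ (s : SL(2, ℤ)) (F : Y → ZMod 2), (∀ g : SL(2, ℤ), F ((g * s)⁻¹ • y0) = F (g⁻¹ • y0)) →
      F ∈ WI Y s := by
    intro s F hF
    rw [mem_WI]
    apply hY
    intro g
    have := hF (g * s⁻¹)
    rw [inv_mul_cancel_right, mul_inv_rev, inv_inv, mul_smul] at this
    exact this.symm
  let ψ0 : (P Γ (Q (-1))).ρ.invariants →+ (Y → ZMod 2) :=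
    { toFun := fun z y => ((z.1 (mkQ _ (sec y)⁻¹) : ℤ) : ZMod 2)
      map_zero' := by
        funext y
        change (((0 : ℤ)) : ZMod 2) = 0
        simp
      map_add' := by
        intro z w
        funext y
        change ((z.1 _ + w.1 _ : ℤ) : ZMod 2) = _
        push_cast
        rfl }
  have hinv : ∀ z : (P Γ (Q (-1))).ρ.invariants, ∀ (γ : Γ) x, z.1 (γ • x) = z.1 x :=
    fun z => (mem_inv_fun _ _).1 z.2
  have hψ0 : ∀ z (g : SL(2, ℤ)), ψ0 z (g⁻¹ • y0) = ((z.1 (mkQ _ g) : ℤ) : ZMod 2) := by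
    intro z g
    exact congrArg (fun n : ℤ => (n : ZMod 2)) (hsec' (fun g => z.1 (mkQ _ g))
      (fun γ hγ g => hinv z ⟨γ, hγ⟩ (mkQ _ g)) g)
  have hinvneg : ∀ g : SL(2, ℤ), (g * -1)⁻¹ • y0 = g⁻¹ • y0 := by
    intro g
    have : (-1 : SL(2, ℤ))⁻¹ = -1 := by decide
    rw [mul_inv_rev, this, mul_smul, hneg]
  let sub := WI Y S ⊔ WI Y Wm
  refine ⟨(Submodule.mkQ sub).toAddMonoidHom.comp ψ0, ?_, ?_⟩
  · refine (Submodule.mkQ_surjective sub).comp ?_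
    intro F
    refine ⟨⟨liftQ (-1) (fun g => ((F (g⁻¹ • y0)).val : ℤ)) (fun g => by rw [hinvneg]), ?_⟩, ?_⟩
    · refine (mem_inv_fun _ _).2 fun γ => mk_ind fun g => ?_
      change ((F ((γ.1 * g)⁻¹ • y0)).val : ℤ) = ((F (g⁻¹ • y0)).val : ℤ)
      rw [mul_inv_rev, mul_smul, (hstab _).2 (inv_mem γ.2)]
    · funext y
      revert y
      apply hY
      intro g
      rw [hψ0]
      change (((F (g⁻¹ • y0)).val : ℤ) : ZMod 2) = _
      simp
  · intro z
    change Submodule.mkQ sub (ψ0 z) = 0 ↔ _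
    rw [Submodule.mkQ_apply, Submodule.Quotient.mk_eq_zero, Submodule.mem_sup]
    constructor
    · rintro ⟨A, hA, B, hB, hAB⟩
      have hAB' : ∀ g : SL(2, ℤ), ∃ q : ℤ, z.1 (mkQ _ g) - (A (g⁻¹ • y0)).val - (B (g⁻¹ • y0)).val
          = 2 * q := by
        intro g
        have h1 := congrFun hAB (g⁻¹ • y0)
        rw [hψ0, Pi.add_apply] at h1
        have h2 : ((z.1 (mkQ _ g) - (A (g⁻¹ • y0)).val - (B (g⁻¹ • y0)).val : ℤ) : ZMod 2) = 0 := by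
          push_cast
          rw [← h1]
          simp
        rw [ZMod.intCast_zmod_eq_zero_iff_dvd] at h2
        exact h2
      have hA' : ∀ g : SL(2, ℤ), A ((g * S)⁻¹ • y0) = A (g⁻¹ • y0) := by
        intro g
        rw [← hA ((g * S)⁻¹ • y0), mul_inv_rev, mul_smul, smul_inv_smul]
      have hB' : ∀ g : SL(2, ℤ), B ((g * Wm)⁻¹ • y0) = B (g⁻¹ • y0) := by
        intro g
        rw [← hB ((g * Wm)⁻¹ • y0), mul_inv_rev, mul_smul, smul_inv_smul]
      have hst : ∀ (γ : Γ) (g : SL(2, ℤ)), (γ.1 * g)⁻¹ • y0 = g⁻¹ • y0 := by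
        intro γ g
        rw [mul_inv_rev, mul_smul, (hstab _).2 (inv_mem γ.2)]
      let q : SL(2, ℤ) → ℤ := fun g =>
        (z.1 (mkQ _ g) - (A (g⁻¹ • y0)).val - (B (g⁻¹ • y0)).val) / 2
      have hq : ∀ g, z.1 (mkQ _ g) - (A (g⁻¹ • y0)).val - (B (g⁻¹ • y0)).val = 2 * q g := by
        intro g
        obtain ⟨r, hr⟩ := hAB' g
        change _ = 2 * ((z.1 (mkQ _ g) - (A (g⁻¹ • y0)).val - (B (g⁻¹ • y0)).val) / 2)
        omega
      have hqneg : ∀ g, q (g * -1) = q g := by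
        intro g
        change (z.1 (mkQ _ (g * -1)) - _ - _) / 2 = _
        rw [hinvneg, mkQ_mul]
      have hqΓ : ∀ (γ : Γ) g, q (γ.1 * g) = q g := by
        intro γ g
        change (z.1 (mkQ _ (γ.1 * g)) - _ - _) / 2 = _
        rw [hst, ← smul_mkQ, hinv]
      refine ⟨Sum.elim (Sum.elim
        (liftQ S (fun g => ((A (g⁻¹ • y0)).val : ℤ)) (fun g => by rw [hA']))
        (liftQ Wm (fun g => -((B (g⁻¹ • y0)).val : ℤ)) (fun g => by rw [hB'])))
        (fun e => - liftQ (-1) q hqneg e.1 *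
          if ∃ h, mkQ (-1) h = e.1 ∧ chiG h = e.2 then (1 : ℤ) else 0), ?_, ?_⟩
      · refine (mem_inv_fun _ _).2 ?_
        rintro γ ((x | x) | ⟨x, j⟩)
        · revert x
          refine mk_ind fun g => ?_
          change ((A ((γ.1 * g)⁻¹ • y0)).val : ℤ) = ((A (g⁻¹ • y0)).val : ℤ)
          rw [hst]
        · revert x
          refine mk_ind fun g => ?_
          change -((B ((γ.1 * g)⁻¹ • y0)).val : ℤ) = -((B (g⁻¹ • y0)).val : ℤ)
          rw [hst]
        · revert x
          refine mk_ind fun g => ?_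
          change -q (γ.1 * g) * (if ∃ h, mkQ (-1) h = mkQ (-1) (γ.1 * g) ∧
            chiG h = chiG γ.1 + j then (1 : ℤ) else 0) =
            -q g * (if ∃ h, mkQ (-1) h = mkQ (-1) g ∧ chiG h = j then (1 : ℤ) else 0)
          rw [hqΓ]
          congr 1
          apply if_congr ?_ rfl rfl
          constructor
          · rintro ⟨h, h1, h2⟩
            refine ⟨γ.1⁻¹ * h, ?_, ?_⟩
            · obtain ⟨k, hk⟩ := (mkQ_eq _ _ _).1 h1
              refine (mkQ_eq _ _ _).2 ⟨k, ?_⟩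
              rw [mul_assoc, ← hk, inv_mul_cancel_left]
            · rw [chiG_mul, h2, chiG_inv]; ring
          · rintro ⟨h, h1, h2⟩
            refine ⟨γ.1 * h, ?_, ?_⟩
            · obtain ⟨k, hk⟩ := (mkQ_eq _ _ _).1 h1
              refine (mkQ_eq _ _ _).2 ⟨k, ?_⟩
              rw [hk, mul_assoc]
            · rw [chiG_mul, h2]
      · funext e
        revert e
        refine mk_ind fun g => ?_
        rw [mm_apply]
        change ((A (g⁻¹ • y0)).val : ℤ) - -((B (g⁻¹ • y0)).val : ℤ) -
          ∑ j : ZMod 12, (-q g * (if ∃ h, mkQ (-1) h = mkQ (-1) g ∧ chiG h = j then (1 : ℤ) else 0)) = _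
        rw [← Finset.mul_sum, ind_sum]
        linarith [hq g]
    · rintro ⟨y, hy, hyz⟩
      have hy' := (mem_inv_fun _ _).1 hy
      have hz : ∀ g, z.1 (mkQ _ g) = y (Sum.inl (Sum.inl (mkQ _ g))) - y (Sum.inl (Sum.inr (mkQ _ g)))
          - ∑ j, y (Sum.inr (mkQ _ g, j)) := by
        intro g
        rw [← hyz]; rfl
      have hA := hsec' (fun g => y (Sum.inl (Sum.inl (mkQ _ g)))) (fun γ hγ g =>
        hy' ⟨γ, hγ⟩ (Sum.inl (Sum.inl (mkQ _ g))))
      have hB := hsec' (fun g => y (Sum.inl (Sum.inr (mkQ _ g)))) (fun γ hγ g =>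
        hy' ⟨γ, hγ⟩ (Sum.inl (Sum.inr (mkQ _ g))))
      refine ⟨fun x => ((y (Sum.inl (Sum.inl (mkQ _ (sec x)⁻¹))) : ℤ) : ZMod 2), ?_,
        fun x => ((- y (Sum.inl (Sum.inr (mkQ _ (sec x)⁻¹))) : ℤ) : ZMod 2), ?_, ?_⟩
      · apply hWI
        intro g
        simp only [hA, mkQ_mul]
      · apply hWI
        intro g
        simp only [hB, mkQ_mul]
      · funext x
        revert x
        apply hY
        intro g
        rw [hψ0, Pi.add_apply, hz]
        simp only [hA, hB]
        have h6 := sum_even (fun j => y (Sum.inr (mkQ _ g, j))) (by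
          intro j
          have h7 := hy' ⟨-1, hnegΓ⟩ (Sum.inr (mkQ _ g, j))
          have h8 : (⟨-1, hnegΓ⟩ : Γ) • (Sum.inr (mkQ (-1) g, j) : (Q S ⊕ Q Wm) ⊕ (Q (-1) × Z12)) =
              Sum.inr (mkQ (-1) g, 6 + j) := by
            change Sum.inr (mkQ (-1) (-1 * g), chiG (-1) + j) = _
            rw [chiG_neg_one, neg_one_mul, ← mkQ_mul (-1) g, mul_neg, mul_one]
          exact (congrArg y h8).symm.trans h7)
        push_cast at h6 ⊢
        rw [h6]
        ring

end Coker

section Orbits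

/-- invariant functions of a permutation -/
def WP {Y : Type} (σ : Equiv.Perm Y) : Submodule (ZMod 2) (Y → ZMod 2) where
  carrier := {F | ∀ y, F (σ y) = F y}
  add_mem' := by intro a b ha hb y; simp only [Pi.add_apply, ha y, hb y]
  zero_mem' := by intro y; rfl
  smul_mem' := by intro c a ha y; simp only [Pi.smul_apply, ha y]

theorem finrank_WP {Y : Type} [Finite Y] (σ : Equiv.Perm Y) (q : ℕ) (hq : q.Prime)
    (h1 : σ ^ q = 1) (h2 : σ ≠ 1) :
    q * Module.finrank (ZMod 2) (WP σ) = Nat.card Y + (q - 1) * Nat.card {y // σ y = y} := by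
  classical
  have := Fintype.ofFinite Y
  have : Fact q.Prime := ⟨hq⟩
  let Ω := MulAction.orbitRel.Quotient (Subgroup.zpowers σ) Y
  have : Fintype Ω := Fintype.ofFinite _
  have ho : orderOf σ = q := orderOf_eq_prime h1 h2
  have hb := MulAction.sum_card_fixedBy_eq_card_orbits_mul_card_group (Subgroup.zpowers σ) Y
  rw [Fintype.card_zpowers, ho] at hb
  have hfix : ∀ a : Subgroup.zpowers σ, a ≠ 1 →
      Fintype.card (MulAction.fixedBy Y a) = Nat.card {y // σ y = y} := by
    intro a ha
    rw [← Nat.card_eq_fintype_card]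
    have hgen : (⟨σ, Subgroup.mem_zpowers σ⟩ : Subgroup.zpowers σ) ∈ Subgroup.zpowers a :=
      mem_zpowers_of_prime_card (p := q) (by rw [Nat.card_zpowers, ho]) ha
    obtain ⟨m, hm⟩ := hgen
    have hm' : a.1 ^ m = σ := by
      have := congrArg Subtype.val hm
      simpa using this
    obtain ⟨k, hk⟩ := a.2
    apply Nat.card_congr
    apply Equiv.subtypeEquivRight
    intro y
    constructor
    · intro h
      have h' : a.1 ∈ MulAction.stabilizer (Equiv.Perm Y) y := h
      have h3 := zpow_mem h' m
      rw [hm'] at h3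
      exact h3
    · intro h
      have h' : σ ∈ MulAction.stabilizer (Equiv.Perm Y) y := h
      have h3 := zpow_mem h' k
      change σ ^ k = a.1 at hk
      rw [hk] at h3
      exact h3
  rw [← Finset.add_sum_erase _ _ (Finset.mem_univ (1 : Subgroup.zpowers σ)),
    Finset.sum_congr rfl (fun a ha => hfix a (Finset.ne_of_mem_erase ha)), Finset.sum_const,
    Finset.card_erase_of_mem (Finset.mem_univ _), Finset.card_univ, Fintype.card_zpowers, ho] at hb
  have hone : Fintype.card (MulAction.fixedBy Y (1 : Subgroup.zpowers σ)) = Nat.card Y := by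
    rw [← Nat.card_eq_fintype_card, MulAction.fixedBy_one_eq_univ, Nat.card_univ]
  have hrange : LinearMap.range (LinearMap.funLeft (ZMod 2) (ZMod 2) (Quotient.mk _ : Y → Ω)) = WP σ := by
    ext F
    constructor
    · rintro ⟨f, rfl⟩ y
      change f (Quotient.mk _ (σ y)) = f (Quotient.mk _ y)
      congr 1
      exact Quotient.sound ⟨⟨σ, Subgroup.mem_zpowers σ⟩, rfl⟩
    · intro hF
      have hF' : ∀ y, F (σ y) = F y := hF
      have hpow : ∀ (k : ℤ) y, F ((σ ^ k) y) = F y := by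
        intro k
        induction k with
        | zero => simp
        | succ n ih =>
          intro y
          rw [zpow_add_one, Equiv.Perm.mul_apply, ih, hF']
        | pred n ih =>
          intro y
          rw [zpow_sub_one, Equiv.Perm.mul_apply, ih, ← hF' (σ⁻¹ y), show σ (σ⁻¹ y) = y from σ.apply_symm_apply y]
      refine ⟨Quotient.lift F ?_, rfl⟩
      rintro x y ⟨⟨_, k, rfl⟩, rfl⟩
      exact hpow k y
  have hfin : Module.finrank (ZMod 2) (WP σ) = Fintype.card Ω := by
    rw [← hrange, LinearMap.finrank_range_of_inj
      (LinearMap.funLeft_injective_of_surjective _ _ _ Quotient.mk_surjective), Module.finrank_fintype_fun_eq_card]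
  rw [hfin, mul_comm, ← hone]
  simp only [smul_eq_mul] at hb
  convert hb.symm

end Orbits

section ProjLine
open ModularGroup MatrixGroups

/-- the projective line over `ZMod p` -/
def Yp (p : ℕ) : Type := OnePoint (ZMod p)

set_option linter.unusedSectionVars false

variable (p : ℕ) [Fact p.Prime]

instance : MulAction SL(2, ℤ) (Yp p) :=
  letI : MulAction (GL (Fin 2) (ZMod p)) (Yp p) := OnePoint.instGLAction
  MulAction.compHom _ (Matrix.SpecialLinearGroup.mapGL (ZMod p) (R := ℤ) (n := Fin 2))

instance : Finite (Yp p) := inferInstanceAs (Finite (Option (ZMod p)))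

lemma card_Yp : Nat.card (Yp p) = p + 1 := by
  change Nat.card (Option (ZMod p)) = _
  rw [Finite.card_option, Nat.card_zmod]

/-- finite points -/
def pt (x : ZMod p) : Yp p := ((x : OnePoint (ZMod p)))
/-- infinity -/
def inf : Yp p := (OnePoint.infty : OnePoint (ZMod p))

lemma pt_inj {x y : ZMod p} : pt p x = pt p y ↔ x = y := OnePoint.coe_eq_coe
lemma inf_ne_pt (x : ZMod p) : inf p ≠ pt p x := OnePoint.infty_ne_coe x
lemma Yp_cases (y : Yp p) : y = inf p ∨ ∃ x, y = pt p x := by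
  rcases y with _ | x
  · left; rfl
  · right; exact ⟨x, rfl⟩

lemma smul_inf (g : SL(2, ℤ)) : g • inf p =
    if (g 1 0 : ZMod p) = 0 then inf p else pt p ((g 0 0 : ZMod p) / (g 1 0 : ZMod p)) :=
  OnePoint.smul_infty_eq_ite (Matrix.SpecialLinearGroup.mapGL (ZMod p) g)

lemma smul_pt (g : SL(2, ℤ)) (x : ZMod p) : g • pt p x =
    if (g 1 0 : ZMod p) * x + (g 1 1 : ZMod p) = 0 then inf p else
      pt p (((g 0 0 : ZMod p) * x + (g 0 1 : ZMod p)) / ((g 1 0 : ZMod p) * x + (g 1 1 : ZMod p))) :=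
  OnePoint.smul_some_eq_ite (g := Matrix.SpecialLinearGroup.mapGL (ZMod p) g)

lemma Yp_stab (g : SL(2, ℤ)) : g • inf p = inf p ↔ g ∈ CongruenceSubgroup.Gamma0 p := by
  rw [smul_inf, CongruenceSubgroup.Gamma0_mem]
  split_ifs with h
  · simp [h]
  · simp [h, (inf_ne_pt p _).symm]

lemma Yp_neg (y : Yp p) : (-1 : SL(2, ℤ)) • y = y := by
  rcases Yp_cases p y with rfl | ⟨x, rfl⟩
  · rw [smul_inf]; simp
  · rw [smul_pt]; simp

lemma S_inf : S • inf p = pt p 0 := by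
  rw [smul_inf]; simp [S]

lemma S_pt (x : ZMod p) : S • pt p x = if x = 0 then inf p else pt p (-1 / x) := by
  rw [smul_pt]; simp [S]

lemma W_inf : Wm • inf p = pt p 0 := by
  rw [smul_inf]; simp [Wm]

lemma W_pt (x : ZMod p) : Wm • pt p x = if 1 - x = 0 then inf p else pt p (1 / (1 - x)) := by
  have h : -x + 1 = 1 - x := by ring
  rw [smul_pt]; simp [Wm, h]

lemma T_pt (x : ZMod p) : T • pt p x = pt p (x + 1) := by
  rw [smul_pt]; simp [T]

lemma Yp_trans (y : Yp p) : ∃ g : SL(2, ℤ), g • inf p = y := by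
  rcases Yp_cases p y with rfl | ⟨x, rfl⟩
  · exact ⟨1, one_smul _ _⟩
  · have : ∀ n : ℕ, (T ^ n * S) • inf p = pt p n := by
      intro n
      induction n with
      | zero => rw [pow_zero, one_mul, S_inf]; simp
      | succ n ih => rw [pow_succ', mul_assoc, mul_smul, ih, T_pt]; push_cast; rfl
    refine ⟨T ^ x.val * S, ?_⟩
    rw [this]; simp

lemma S_fix (y : Yp p) : S • y = y ↔ ∃ x : ZMod p, y = pt p x ∧ x ^ 2 = -1 := by
  rcases Yp_cases p y with rfl | ⟨x, rfl⟩
  · rw [S_inf]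
    simp [inf_ne_pt, (inf_ne_pt p 0).symm]
  · rw [S_pt]
    simp only [pt_inj]
    split_ifs with h
    · simp [inf_ne_pt, h]
    · simp only [pt_inj, exists_eq_left']
      rw [div_eq_iff h, pow_two, eq_comm]

lemma W_fix (y : Yp p) : Wm • y = y ↔ ∃ x : ZMod p, y = pt p x ∧ x ^ 2 - x + 1 = 0 := by
  rcases Yp_cases p y with rfl | ⟨x, rfl⟩
  · rw [W_inf]
    simp [inf_ne_pt, (inf_ne_pt p 0).symm]
  · rw [W_pt]
    simp only [pt_inj]
    split_ifs with h
    · have : x = 1 := by linear_combination -h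
      subst this
      simp [inf_ne_pt]
    · simp only [pt_inj, exists_eq_left']
      rw [div_eq_iff h]
      constructor
      · intro h; linear_combination h
      · intro h; linear_combination h

lemma card_S_fix (hp : 3 < p) : Nat.card {y : Yp p // S • y = y} = if p % 4 = 3 then 0 else 2 := by
  have hiff := ZMod.exists_sq_eq_neg_one_iff (p := p)
  split_ifs with h
  · have : IsEmpty {y : Yp p // S • y = y} := by
      constructor
      rintro ⟨y, hy⟩
      obtain ⟨x, -, hx⟩ := (S_fix p y).1 hy
      exact hiff.1 ⟨x, by rw [← hx, pow_two]⟩ h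
    exact Nat.card_of_isEmpty
  · obtain ⟨r, hr⟩ := hiff.2 h
    have h2 : (2 : ZMod p) ≠ 0 := by
      intro h0
      have := (ZMod.natCast_eq_zero_iff 2 p).1 (by exact_mod_cast h0)
      have := Nat.le_of_dvd (by norm_num) this
      omega
    have hr0 : r ≠ 0 := by rintro rfl; simp at hr
    have hne : pt p r ≠ pt p (-r) := by
      rw [Ne, pt_inj]
      intro h0
      have : 2 * r = 0 := by linear_combination h0
      exact (mul_ne_zero h2 hr0) this
    have hset : {y : Yp p | S • y = y} = {pt p r, pt p (-r)} := by
      ext y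
      rw [Set.mem_ofPred_eq, S_fix]
      constructor
      · rintro ⟨x, rfl, hx⟩
        have : (x - r) * (x + r) = 0 := by linear_combination hx + hr
        rcases mul_eq_zero.1 this with h0 | h0
        · left; rw [sub_eq_zero.1 h0]
        · right; rw [Set.mem_singleton_iff, pt_inj]; linear_combination h0
      · rintro (rfl | rfl)
        · exact ⟨r, rfl, by linear_combination -hr⟩
        · exact ⟨-r, rfl, by linear_combination -hr⟩
    change Nat.card ({y : Yp p | S • y = y} : Set (Yp p)) = 2
    rw [hset, Nat.card_coe_set_eq, Set.ncard_pair hne]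

lemma card_W_fix : Nat.card {y : Yp p // Wm • y = y} ≤ 2 := by
  change Nat.card ({y : Yp p | Wm • y = y} : Set (Yp p)) ≤ 2
  rw [Nat.card_coe_set_eq]
  by_cases h : ∃ r : ZMod p, r ^ 2 - r + 1 = 0
  · obtain ⟨r, hr⟩ := h
    refine (Set.ncard_le_ncard (t := {pt p r, pt p (1 - r)}) ?_ (Set.toFinite _)).trans
      (Set.ncard_insert_le _ _ |>.trans (by simp))
    intro y hy
    obtain ⟨x, rfl, hx⟩ := (W_fix p y).1 hy
    have : (x - r) * (x - (1 - r)) = 0 := by linear_combination hx - hr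
    rcases mul_eq_zero.1 this with h0 | h0
    · left; rw [sub_eq_zero.1 h0]
    · right; rw [Set.mem_singleton_iff, sub_eq_zero.1 h0]
  · have : {y : Yp p | Wm • y = y} = ∅ := by
      ext y
      simp only [Set.mem_ofPred_eq, Set.mem_empty_iff_false, iff_false, W_fix]
      rintro ⟨x, -, hx⟩
      exact h ⟨x, hx⟩
    rw [this]; simp

lemma rank_S (hp : 3 < p) : 2 * Module.finrank (ZMod 2) (WI (Yp p) S) =
    p + 1 + if p % 4 = 3 then 0 else 2 := by
  have h := finrank_WP (MulAction.toPerm S : Equiv.Perm (Yp p)) 2 Nat.prime_two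
    (by
      ext y
      change S • S • y = y
      rw [← mul_smul, ← pow_two, S_sq, Yp_neg])
    (by
      intro h0
      have : S • inf p = inf p := congrFun (congrArg DFunLike.coe h0) (inf p)
      rw [S_inf] at this
      exact inf_ne_pt p 0 this.symm)
  rw [card_Yp, show 2 - 1 = 1 from rfl, one_mul] at h
  rw [← card_S_fix p hp]
  exact h

lemma rank_W : ∃ f ≤ 2, 3 * Module.finrank (ZMod 2) (WI (Yp p) Wm) = p + 1 + 2 * f := by
  have h := finrank_WP (MulAction.toPerm Wm : Equiv.Perm (Yp p)) 3 Nat.prime_three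
    (by
      ext y
      change Wm • Wm • Wm • y = y
      rw [← mul_smul, ← mul_smul, ← pow_two, ← pow_succ, W_cube, Yp_neg])
    (by
      intro h0
      have : Wm • inf p = inf p := congrFun (congrArg DFunLike.coe h0) (inf p)
      rw [W_inf] at this
      exact inf_ne_pt p 0 this.symm)
  rw [card_Yp] at h
  exact ⟨_, card_W_fix p, h⟩

lemma inf_WI : Module.finrank (ZMod 2) (WI (Yp p) S ⊓ WI (Yp p) Wm : Submodule _ _) = 1 := by
  have : (WI (Yp p) S ⊓ WI (Yp p) Wm : Submodule _ _) = Submodule.span (ZMod 2) {fun _ => 1} := by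
    ext F
    rw [Submodule.mem_span_singleton]
    constructor
    · rintro ⟨h1, h2⟩
      refine ⟨F (inf p), ?_⟩
      funext y
      obtain ⟨g, rfl⟩ := Yp_trans p y
      have key := const_of (fun g => F (g⁻¹ • inf p))
        (fun g => by
          rw [mul_inv_rev, mul_smul, ← h1 (S⁻¹ • _), smul_inv_smul])
        (fun g => by
          rw [mul_inv_rev, mul_smul, ← h2 (Wm⁻¹ • _), smul_inv_smul]) g⁻¹
      simp only [inv_inv, inv_one, one_smul] at key
      simp [key]
    · rintro ⟨c, rfl⟩
      exact ⟨fun y => rfl, fun y => rfl⟩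
  rw [this]
  apply finrank_span_singleton
  intro h
  have := congrFun h (inf p)
  simp at this

theorem rank_K (hp3 : 3 < p) (N : ℕ)
    (hN : (p % 12 = 1 ∧ N = (p - 7) / 6) ∨ (p % 12 = 5 ∧ N = (p + 1) / 6) ∨
      (p % 12 = 7 ∧ N = (p - 1) / 6) ∨ (p % 12 = 11 ∧ N = (p + 7) / 6)) :
    Module.finrank (ZMod 2) ((Yp p → ZMod 2) ⧸ (WI (Yp p) S ⊔ WI (Yp p) Wm)) = N := by
  have := Fintype.ofFinite (Yp p)
  have h1 := Submodule.finrank_sup_add_finrank_inf_eq (WI (Yp p) S) (WI (Yp p) Wm)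
  have h2 := Submodule.finrank_quotient_add_finrank (WI (Yp p) S ⊔ WI (Yp p) Wm)
  rw [Module.finrank_fintype_fun_eq_card, ← Nat.card_eq_fintype_card, card_Yp] at h2
  rw [inf_WI] at h1
  have h3 := rank_S p hp3
  obtain ⟨f, hf, h4⟩ := rank_W p
  split_ifs at h3 <;> omega

end ProjLine

section Final

/-- the trivial representation as functions on a point -/
noncomputable def trivIso (Γ : Type) [Group Γ] : P Γ PUnit.{1} ≅ Rep.trivial ℤ Γ ℤ where
  hom := Rep.ofHom
    { toFun := fun f => f PUnit.unit
      map_add' := fun _ _ => rfl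
      map_smul' := fun _ _ => rfl
      isIntertwining' := fun _ => rfl }
  inv := Rep.ofHom
    { toFun := fun n _ => n
      map_add' := fun _ _ => rfl
      map_smul' := fun _ _ => rfl
      isIntertwining' := fun _ => rfl }
  hom_inv_id := rfl
  inv_hom_id := rfl

lemma equiv_of_two {A H K : Type} [AddCommGroup A] [AddCommGroup H] [AddCommGroup K]
    (φ : A →+ H) (ψ : A →+ K) (hφ : Function.Surjective φ) (hψ : Function.Surjective ψ)
    (h : ∀ z, φ z = 0 ↔ ψ z = 0) : Nonempty (H ≃+ K) := by
  have hk : φ.ker = ψ.ker := by ext z; exact h z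
  exact ⟨(QuotientAddGroup.quotientKerEquivOfSurjective φ hφ).symm.trans
    ((QuotientAddGroup.quotientAddEquivOfEq hk).trans
      (QuotientAddGroup.quotientKerEquivOfSurjective ψ hψ))⟩

lemma linEquiv_of {H K : Type} [AddCommGroup H] [AddCommGroup K] [Module ℤ H] [Module ℤ K]
    (e : H ≃+ K) : Nonempty (H ≃ₗ[ℤ] K) :=
  ⟨{ e with map_smul' := fun n x => (map_intCast_smul e ℤ ℤ n x) }⟩

theorem final (p : ℕ) (hp : p.Prime) (hp3 : 3 < p) (N : ℕ)
    (hN : (p % 12 = 1 ∧ N = (p - 7) / 6) ∨ (p % 12 = 5 ∧ N = (p + 1) / 6) ∨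
      (p % 12 = 7 ∧ N = (p - 1) / 6) ∨ (p % 12 = 11 ∧ N = (p + 7) / 6))
    (i : ℕ) (hi : 1 ≤ i) :
    Nonempty ((groupCohomology (Rep.trivial ℤ (CongruenceSubgroup.Gamma0 p) ℤ) (2 * i + 1)) ≃ₗ[ℤ]
      (Fin N → ZMod 2)) := by
  have : Fact p.Prime := ⟨hp⟩
  obtain ⟨j, rfl⟩ : ∃ j, i = j + 1 := ⟨i - 1, by omega⟩
  rw [show 2 * (j + 1) + 1 = 2 * j + 3 by ring]
  obtain ⟨φ, hφ, hφ0⟩ := main2 (CongruenceSubgroup.Gamma0 p) j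
  obtain ⟨ψ, hψ, hψ0⟩ := coker_iso (CongruenceSubgroup.Gamma0 p) (inf p) (Yp_stab p) (Yp_trans p)
    (Yp_neg p)
  obtain ⟨e1⟩ := equiv_of_two φ.toAddMonoidHom ψ hφ hψ (fun z => (hφ0 z).trans (hψ0 z).symm)
  have hr := rank_K p hp3 N hN
  have e2 := LinearEquiv.ofFinrankEq (R := ZMod 2) _ (Fin N → ZMod 2)
    (hr.trans (Module.finrank_fin_fun (ZMod 2)).symm)
  have e3 := ((groupCohomology.functor ℤ (CongruenceSubgroup.Gamma0 p) (2 * j + 3)).mapIso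
    (trivIso (CongruenceSubgroup.Gamma0 p))).toLinearEquiv
  exact linEquiv_of ((e3.symm.toAddEquiv.trans e1).trans e2.toAddEquiv)

end Final

end OddCoh

end OddCohAux

open CongruenceSubgroup

/-- For a prime `p > 3` and any `i ≥ 1`, the odd-dimensional integral cohomology
`H^{2i+1}(Γ₀(p), ℤ)` is elementary abelian of rank `N(p)`. -/
theorem odd_cohomology_Gamma0 (p : ℕ) (hp : p.Prime) (hp3 : 3 < p) (N : ℕ)
    (hN : (p % 12 = 1 ∧ N = (p - 7) / 6) ∨ (p % 12 = 5 ∧ N = (p + 1) / 6) ∨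
      (p % 12 = 7 ∧ N = (p - 1) / 6) ∨ (p % 12 = 11 ∧ N = (p + 7) / 6))
    (i : ℕ) (hi : 1 ≤ i) :
    Nonempty ((groupCohomology (Rep.trivial ℤ (Gamma0 p) ℤ) (2 * i + 1)) ≃ₗ[ℤ]
      (Fin N → ZMod 2)) := by
  exact OddCoh.final p hp hp3 N hN i hi
end

section
/- Let p be a prime. Then the abelianization H₁(SL₂(ℤ[1/p]), ℤ) is isomorphic to ℤ/3 if p = 2, to ℤ/4 if p = 3, and to ℤ/12 if p > 3. -/
namespace SLab

open Matrix

section gen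
variable {R : Type*} [CommRing R]

/-- upper elementary matrix -/
def up (r : R) : SpecialLinearGroup (Fin 2) R := ⟨!![1, r; 0, 1], by simp [Matrix.det_fin_two]⟩
/-- lower elementary matrix -/
def lo (r : R) : SpecialLinearGroup (Fin 2) R := ⟨!![1, 0; r, 1], by simp [Matrix.det_fin_two]⟩
/-- the Weyl element -/
def ww : SpecialLinearGroup (Fin 2) R := ⟨!![0, 1; -1, 0], by simp [Matrix.det_fin_two]⟩
/-- diagonal matrix -/
def dg (u : Rˣ) : SpecialLinearGroup (Fin 2) R :=
  ⟨!![(u : R), 0; 0, ((u⁻¹ : Rˣ) : R)], by simp [Matrix.det_fin_two]⟩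

theorem val_mul (a b : SpecialLinearGroup (Fin 2) R) : (a * b).1 = a.1 * b.1 := rfl
theorem val_up (r : R) : (up r).1 = !![1, r; 0, 1] := rfl
theorem val_lo (r : R) : (lo r).1 = !![1, 0; r, 1] := rfl
theorem val_ww : (ww : SpecialLinearGroup (Fin 2) R).1 = !![0, 1; -1, 0] := rfl
theorem val_dg (u : Rˣ) : (dg u).1 = !![(u : R), 0; 0, ((u⁻¹ : Rˣ) : R)] := rfl

theorem up_add (r s : R) : up (r + s) = up r * up s := by
  apply Subtype.ext
  simp [val_mul, val_up, Matrix.mul_fin_two, add_comm]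

theorem ww_eq : (ww : SpecialLinearGroup (Fin 2) R) = up 1 * lo (-1) * up 1 := by
  apply Subtype.ext
  simp [val_mul, val_up, val_lo, val_ww, Matrix.mul_fin_two]

theorem ww_pow : (ww : SpecialLinearGroup (Fin 2) R) ^ 4 = 1 := by
  rw [pow_succ, pow_succ, pow_two]
  apply Subtype.ext
  change _ = (1 : Matrix (Fin 2) (Fin 2) R)
  simp [val_mul, val_ww, Matrix.mul_fin_two, Matrix.one_fin_two]

theorem ww_conj (r : R) : ww * up r = lo (-r) * ww := by
  apply Subtype.ext
  simp [val_mul, val_up, val_lo, val_ww, Matrix.mul_fin_two]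

theorem dg_conj (u : Rˣ) (r : R) : dg u * up r = up ((u : R) ^ 2 * r) * dg u := by
  apply Subtype.ext
  have : (u : R) ^ 2 * r * ((u⁻¹ : Rˣ) : R) = u * r := by
    rw [show (u : R) ^ 2 * r * ((u⁻¹ : Rˣ) : R) = u * r * (u * ((u⁻¹ : Rˣ) : R)) by ring]
    simp
  simp [val_mul, val_up, val_dg, Matrix.mul_fin_two, this]

theorem dg_eq (u : Rˣ) :
    dg u * ww = up (u : R) * lo (-((u⁻¹ : Rˣ) : R)) * up (u : R) := by
  apply Subtype.ext
  simp [val_mul, val_up, val_lo, val_ww, val_dg, Matrix.mul_fin_two]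

/-- the additive character -/
def phi (r : R) : Abelianization (SpecialLinearGroup (Fin 2) R) := Abelianization.of (up r)

theorem phi_add (r s : R) : phi (r + s) = phi r * phi s := by
  simp [phi, up_add]

/-- phi as a hom -/
def phiHom : Multiplicative R →* Abelianization (SpecialLinearGroup (Fin 2) R) :=
  MonoidHom.mk' (fun r => phi r.toAdd) (fun _ _ => phi_add _ _)

theorem phi_int (z : ℤ) : phi (z : R) = phi (1 : R) ^ z := by
  have := map_zpow (phiHom (R := R)) (Multiplicative.ofAdd 1) z
  rw [← ofAdd_zsmul] at this
  simpa [phiHom] using this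

theorem of_lo (r : R) : Abelianization.of (lo r) = phi (-r) := by
  have := congrArg Abelianization.of (ww_conj (-r))
  rw [map_mul, map_mul, mul_comm, neg_neg] at this
  exact (mul_right_cancel this).symm

theorem phi_sq (u : Rˣ) (r : R) : phi ((u : R) ^ 2 * r) = phi r := by
  have := congrArg Abelianization.of (dg_conj u r)
  rw [map_mul, map_mul, mul_comm] at this
  exact (mul_right_cancel this).symm

theorem phi_twelve : phi (1 : R) ^ 12 = 1 := by
  have h : Abelianization.of (ww : SpecialLinearGroup (Fin 2) R) = phi 1 ^ 3 := by
    rw [ww_eq, map_mul, map_mul, of_lo, neg_neg]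
    change phi 1 * phi 1 * phi 1 = _
    rw [pow_succ, pow_two]
  have h2 := congrArg Abelianization.of (ww_pow (R := R))
  rw [map_pow, h, ← pow_mul, map_one] at h2
  exact h2

end gen

section loc
variable {R : Type*} [CommRing R]

theorem mem_N (H : Subgroup (SpecialLinearGroup (Fin 2) R)) (hu : ∀ r, up r ∈ H)
    (hl : ∀ r, lo r ∈ H) (hR : ∀ r : R, ∃ (z : ℤ) (u : Rˣ), r = z * u) (n : ℕ) :
    ∀ (g : SpecialLinearGroup (Fin 2) R) (z : ℤ) (u : Rˣ), z.natAbs = n → g.1 1 0 = z * u →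
      g ∈ H := by
  have hw : ww ∈ H := by
    rw [ww_eq]; exact H.mul_mem (H.mul_mem (hu _) (hl _)) (hu _)
  have hd : ∀ u, dg u ∈ H := fun u => by
    rw [← H.mul_mem_cancel_right hw, dg_eq]
    exact H.mul_mem (H.mul_mem (hu _) (hl _)) (hu _)
  induction n using Nat.strong_induction_on with
  | _ n ih =>
  intro g z u hz hg
  have hdet := g.2
  rw [Matrix.det_fin_two] at hdet
  by_cases h0 : z = 0
  · subst h0
    have hc : g.1 1 0 = 0 := by simpa using hg
    rw [hc, mul_zero, sub_zero] at hdet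
    let v : Rˣ := ⟨g.1 0 0, g.1 1 1, hdet, by rw [mul_comm]; exact hdet⟩
    have : g = dg v * up (g.1 1 1 * g.1 0 1) := by
      apply Subtype.ext
      rw [Matrix.eta_fin_two g.1]
      simp [val_mul, val_up, val_dg, v, Matrix.mul_fin_two, hc, ← mul_assoc, hdet]
    rw [this]
    exact H.mul_mem (hd _) (hu _)
  · obtain ⟨m, v, hm⟩ := hR (g.1 0 0)
    let r : R := -(((m / z : ℤ) : R) * v * ((u⁻¹ : Rˣ) : R))
    rw [← H.mul_mem_cancel_left (hu r), ← H.mul_mem_cancel_left hw]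
    refine ih (m % z).natAbs ?_ _ (m % z) (-v) rfl ?_
    · have h1 := Int.emod_nonneg m h0
      have h2 := Int.emod_lt_abs m h0
      rw [Int.abs_eq_natAbs] at h2
      omega
    · have e : (ww * (up r * g)).1 1 0 = -(g.1 0 0 + r * g.1 1 0) := by
        simp [val_ww, val_up, Matrix.mul_apply, Matrix.vecMul, dotProduct, Fin.sum_univ_two]
      have hmod : ((m % z : ℤ) : R) = m - z * ((m / z : ℤ) : R) := by
        rw [Int.emod_def]; push_cast; ring
      have huu : ((u⁻¹ : Rˣ) : R) * u = 1 := by simp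
      rw [e, hm, hg, hmod]
      simp only [r, Units.val_neg]
      linear_combination ((z : R) * ((m / z : ℤ) : R) * v) * huu

end loc

/-- mod 3 character -/
def c3 (a b c d : ZMod 3) : ZMod 3 := (1 - c ^ 2) * (b * d) + c * (a + d)
/-- mod 4 character -/
def c4 (a b c d : ZMod 4) : ZMod 4 :=
  (1 - c ^ 2) * (b * d + 3 * (c - 1) * d + c + 3) + c * (a + d - 3)

theorem c3_mul : ∀ a b c d : ZMod 3, a * d - b * c = 1 → ∀ e f g h : ZMod 3, e * h - f * g = 1 →
    c3 (a * e + b * g) (a * f + b * h) (c * e + d * g) (c * f + d * h) =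
      c3 a b c d + c3 e f g h := by
  decide +kernel

theorem c4_mul : ∀ a b c d : ZMod 4, a * d - b * c = 1 → ∀ e f g h : ZMod 4, e * h - f * g = 1 →
    c4 (a * e + b * g) (a * f + b * h) (c * e + d * g) (c * f + d * h) =
      c4 a b c d + c4 e f g h := by
  decide +kernel

/-- the character of SL2(Z/3) -/
def chi3 : SpecialLinearGroup (Fin 2) (ZMod 3) →* Multiplicative (ZMod 3) :=
  MonoidHom.mk' (fun g => Multiplicative.ofAdd (c3 (g.1 0 0) (g.1 0 1) (g.1 1 0) (g.1 1 1)))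
    (fun g h => by
      have hg := g.2
      have hh := h.2
      rw [Matrix.det_fin_two] at hg hh
      have := c3_mul _ _ _ _ hg _ _ _ _ hh
      rw [← ofAdd_add, ← this]
      simp [Matrix.mul_apply, Fin.sum_univ_two])

/-- the character of SL2(Z/4) -/
def chi4 : SpecialLinearGroup (Fin 2) (ZMod 4) →* Multiplicative (ZMod 4) :=
  MonoidHom.mk' (fun g => Multiplicative.ofAdd (c4 (g.1 0 0) (g.1 0 1) (g.1 1 0) (g.1 1 1)))
    (fun g h => by
      have hg := g.2
      have hh := h.2
      rw [Matrix.det_fin_two] at hg hh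
      have := c4_mul _ _ _ _ hg _ _ _ _ hh
      rw [← ofAdd_add, ← this]
      simp [Matrix.mul_apply, Fin.sum_univ_two])

theorem chi3_up : chi3 (up 1) = Multiplicative.ofAdd 1 := by
  simp only [chi3, up, MonoidHom.mk'_apply]; rfl

theorem chi4_up : chi4 (up 1) = Multiplicative.ofAdd 1 := by
  simp only [chi4, up, MonoidHom.mk'_apply]; rfl

theorem map_up {R S : Type*} [CommRing R] [CommRing S] (f : R →+* S) :
    SpecialLinearGroup.map f (up 1) = up 1 := by
  apply Subtype.ext
  change (up (1 : R)).1.map f = _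
  rw [val_up, val_up]
  ext i j
  fin_cases i <;> fin_cases j <;> simp

section main
variable (p : ℕ)

theorem exists_form (r : Localization.Away (p : ℤ)) : ∃ (z : ℤ) (k : ℕ), (p : Localization.Away (p : ℤ)) ^ k * r = z := by
  obtain ⟨k, z, h⟩ := IsLocalization.Away.surj (p : ℤ) r
  refine ⟨z, k, ?_⟩
  rw [mul_comm]
  simpa using h

theorem isUnit_p : IsUnit (p : Localization.Away (p : ℤ)) := by
  simpa using IsLocalization.Away.algebraMap_isUnit (S := Localization.Away (p : ℤ)) (p : ℤ)

theorem phi_mem (r : Localization.Away (p : ℤ)) : phi r ∈ Subgroup.zpowers (phi (1 : Localization.Away (p : ℤ))) := by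
  obtain ⟨z, k, h⟩ := exists_form p r
  obtain ⟨u, hu⟩ := isUnit_p p
  have h1 := phi_sq (u ^ k) r
  have h2 : ((u ^ k : (Localization.Away (p : ℤ))ˣ) : Localization.Away (p : ℤ)) ^ 2 * r = ((p ^ k * z : ℤ) : Localization.Away (p : ℤ)) := by
    push_cast
    rw [hu, ← h]; ring
  rw [← h1, h2, phi_int]
  exact ⟨_, rfl⟩

theorem phi_p : phi (1 : Localization.Away (p : ℤ)) ^ (p ^ 2) = phi (1 : Localization.Away (p : ℤ)) := by
  obtain ⟨u, hu⟩ := isUnit_p p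
  have h1 := phi_sq u 1
  rw [hu, mul_one] at h1
  have h2 := phi_int (R := Localization.Away (p : ℤ)) ((p ^ 2 : ℕ) : ℤ)
  rw [zpow_natCast] at h2
  rw [← h2]
  push_cast
  exact h1

theorem all_mem (hp : p.Prime) (a : Abelianization (SpecialLinearGroup (Fin 2) (Localization.Away (p : ℤ)))) : a ∈ Subgroup.zpowers (phi (1 : Localization.Away (p : ℤ))) := by
  have hp0 : (p : ℤ) ≠ 0 := by exact_mod_cast hp.ne_zero
  have : IsDomain (Localization.Away (p : ℤ)) := IsLocalization.isDomain_localization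
    (Submonoid.powers_le.mpr (mem_nonZeroDivisors_of_ne_zero hp0))
  obtain ⟨g, rfl⟩ := QuotientGroup.mk_surjective a
  have hR : ∀ r : Localization.Away (p : ℤ), ∃ (z : ℤ) (u : (Localization.Away (p : ℤ))ˣ), r = z * u := by
    intro r
    obtain ⟨z, k, h⟩ := exists_form p r
    obtain ⟨u, hu⟩ := isUnit_p p
    refine ⟨z, (u ^ k)⁻¹, ?_⟩
    rw [Units.eq_mul_inv_iff_mul_eq, ← h, mul_comm]
    simp [hu]
  obtain ⟨z, u, h⟩ := hR (g.1 1 0)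
  exact mem_N ((Subgroup.zpowers (phi (1 : Localization.Away (p : ℤ)))).comap Abelianization.of)
    (fun r => phi_mem p r) (fun r => by
      rw [Subgroup.mem_comap, of_lo]; exact phi_mem p _) hR _ g z u rfl h

theorem iso_of (hp : p.Prime) (n : ℕ) (hn : phi (1 : Localization.Away (p : ℤ)) ^ n = 1) (f : SpecialLinearGroup (Fin 2) (Localization.Away (p : ℤ)) →* Multiplicative (ZMod n))
    (hf : f (up 1) = Multiplicative.ofAdd 1) :
    Nonempty (Abelianization (SpecialLinearGroup (Fin 2) (Localization.Away (p : ℤ))) ≃* Multiplicative (ZMod n)) := by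
  have hF : Abelianization.lift f (phi 1) = Multiplicative.ofAdd 1 := by
    rw [phi, Abelianization.lift_apply_of, hf]
  refine ⟨MulEquiv.ofBijective (Abelianization.lift f) ⟨?_, ?_⟩⟩
  · rw [injective_iff_map_eq_one]
    intro a ha
    obtain ⟨k, rfl⟩ := all_mem p hp a
    simp only [map_zpow, hF] at ha
    rw [← ofAdd_zsmul, ofAdd_eq_one, zsmul_one, ZMod.intCast_zmod_eq_zero_iff_dvd] at ha
    obtain ⟨m, rfl⟩ := ha
    simp only [_root_.zpow_mul, _root_.zpow_natCast, hn, _root_.one_zpow]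
  · intro b
    obtain ⟨k, hk⟩ := ZMod.intCast_surjective b.toAdd
    refine ⟨phi 1 ^ k, ?_⟩
    rw [map_zpow, hF, ← ofAdd_zsmul, zsmul_one, hk]
    rfl

/-- reduction -/
noncomputable def red (n : ℕ) (h : p.Coprime n) : Localization.Away (p : ℤ) →+* ZMod n :=
  IsLocalization.Away.lift (p : ℤ) (g := Int.castRingHom (ZMod n))
    (by simpa using (ZMod.isUnit_iff_coprime p n).mpr h)

/-- the Z/12 character -/
noncomputable def chi12 (h3 : p.Coprime 3) (h4 : p.Coprime 4) : SpecialLinearGroup (Fin 2) (Localization.Away (p : ℤ)) →* Multiplicative (ZMod 12) :=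
  (AddMonoidHom.toMultiplicative
    (ZMod.chineseRemainder (show Nat.Coprime 3 4 by norm_num)).symm.toAddMonoidHom).comp
  (MonoidHom.mk' (fun g => Multiplicative.ofAdd
      ((chi3 (SpecialLinearGroup.map (red p 3 h3) g)).toAdd,
        (chi4 (SpecialLinearGroup.map (red p 4 h4) g)).toAdd))
    (fun a b => by simp only [map_mul, toAdd_mul, ← ofAdd_add, Prod.mk_add_mk]))

theorem chi12_up (h3 : p.Coprime 3) (h4 : p.Coprime 4) :
    chi12 p h3 h4 (up 1) = Multiplicative.ofAdd 1 := by
  simp only [chi12, MonoidHom.comp_apply, MonoidHom.mk'_apply, map_up, chi3_up, chi4_up]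
  exact congrArg Multiplicative.ofAdd
    (map_one (ZMod.chineseRemainder (show Nat.Coprime 3 4 by norm_num)).symm)

end main

end SLab

/-- The abelianization (first integral homology) of `SL₂(ℤ[1/p])` is `ℤ/3` for `p = 2`,
`ℤ/4` for `p = 3`, and `ℤ/12` for primes `p > 3` (Serre). -/
theorem abelianization_SL2_Z_inv_p (p : ℕ) (hp : p.Prime) :
    (p = 2 → Nonempty (Abelianization
      (Matrix.SpecialLinearGroup (Fin 2) (Localization.Away (p : ℤ))) ≃*
        Multiplicative (ZMod 3))) ∧
    (p = 3 → Nonempty (Abelianization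
      (Matrix.SpecialLinearGroup (Fin 2) (Localization.Away (p : ℤ))) ≃*
        Multiplicative (ZMod 4))) ∧
    (3 < p → Nonempty (Abelianization
      (Matrix.SpecialLinearGroup (Fin 2) (Localization.Away (p : ℤ))) ≃*
        Multiplicative (ZMod 12))) := by
  have h12 := SLab.phi_twelve (R := Localization.Away (p : ℤ))
  have hsq := SLab.phi_p p
  refine ⟨fun h => ?_, fun h => ?_, fun h => ?_⟩
  · have h3 : p.Coprime 3 := by rw [h]; norm_num
    refine SLab.iso_of p hp 3 ?_ (SLab.chi3.comp (Matrix.SpecialLinearGroup.map (SLab.red p 3 h3)))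
      (by rw [MonoidHom.comp_apply, SLab.map_up, SLab.chi3_up])
    have e : p ^ 2 = 3 + 1 := by rw [h]; norm_num
    rw [e, pow_succ] at hsq
    exact mul_eq_right.mp hsq
  · have h4 : p.Coprime 4 := by rw [h]; norm_num
    refine SLab.iso_of p hp 4 ?_ (SLab.chi4.comp (Matrix.SpecialLinearGroup.map (SLab.red p 4 h4)))
      (by rw [MonoidHom.comp_apply, SLab.map_up, SLab.chi4_up])
    have e : p ^ 2 = 8 + 1 := by rw [h]; norm_num
    rw [e, pow_succ] at hsq
    have h8 := mul_eq_right.mp hsq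
    rw [show 12 = 4 + 8 from rfl, pow_add, h8, mul_one] at h12
    exact h12
  · have h3 : p.Coprime 3 := (Nat.coprime_primes hp Nat.prime_three).mpr (by omega)
    have h2 : p.Coprime 2 := (Nat.coprime_primes hp Nat.prime_two).mpr (by omega)
    have h4 : p.Coprime 4 := h2.pow_right 2
    exact SLab.iso_of p hp 12 h12 (SLab.chi12 p h3 h4) (SLab.chi12_up p h3 h4)
end
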